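/- Let δ = 1 − (1 + log log 2)/log 2. There is an absolute constant C > 0 with the following property. Let q0 be a prime power and F a finite field with q0² elements with involution x ↦ x^{q0}. Let n ≥ 2, let 1 ≤ k ≤ n/2, and let a ∈ U. Then the number of †-symmetric monic polynomials f of degree n over F with constant coefficient a that have a †-symmetric monic divisor of degree k is at most C·q0^{n−1}·k^{−δ}·(1 + log k)^{−1/2}. -/

import Mathlib

open Polynomial

/-- `f` is †-symmetric with respect to the involution `σ`. -/
def IsDaggerSymm {F : Type} [Field F] (σ : F →+* F) (f : F[X]) : Prop :=
  f.coeff 0 ≠ 0 ∧ (f.map σ).reverse = Polynomial.C (σ (f.coeff 0)) * f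

/-- The Ford constant `δ = 1 - (1 + log log 2)/log 2 ≈ 0.086`. -/
noncomputable def fordDelta : ℝ := 1 - (1 + Real.log (Real.log 2)) / Real.log 2

lemma half_lt_log_two : (2 / 3 : ℝ) < Real.log 2 := by
  have := Real.log_two_gt_d9
  linarith

lemma log_two_lt : Real.log 2 < (7 / 10 : ℝ) := by
  have := Real.log_two_lt_d9
  linarith

lemma fordDelta_eq : (1 - fordDelta) * Real.log 2 = 1 + Real.log (Real.log 2) := by
  have := half_lt_log_two
  unfold fordDelta
  field_simp
  ring

lemma one_add_log_log_two_mem : 0 ≤ 1 + Real.log (Real.log 2) ∧ 1 + Real.log (Real.log 2) ≤ 1 := by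
  have h1 := half_lt_log_two
  have h2 := log_two_lt
  constructor
  · have h := Real.one_sub_inv_le_log_of_pos (show (0 : ℝ) < Real.log 2 by linarith)
    have : (Real.log 2)⁻¹ ≤ 2 := by
      rw [inv_le_comm₀ (by linarith) (by norm_num)]; linarith
    linarith
  · have := Real.log_nonpos (x := Real.log 2) (by linarith) (by linarith)
    linarith

/-- The Poisson term at `⌈x / log 2⌉`. -/
lemma pow_div_factorial_le {x : ℝ} (hx : 1 ≤ x) :
    x ^ ⌈x / Real.log 2⌉₊ / (⌈x / Real.log 2⌉₊.factorial : ℝ) ≤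
      Real.exp 1 * Real.exp (x * (1 - fordDelta)) / √x := by
  have h1 := half_lt_log_two
  have h2 := log_two_lt
  have hl : 0 < Real.log 2 := by linarith
  set M := ⌈x / Real.log 2⌉₊ with hM
  have hMx : x / Real.log 2 ≤ M := Nat.le_ceil _
  have hMx' : (M : ℝ) < x / Real.log 2 + 1 := Nat.ceil_lt_add_one (by positivity)
  have hxM : x ≤ M * Real.log 2 := by rwa [div_le_iff₀ hl] at hMx
  have hM0 : (0 : ℝ) < M := by
    by_contra h
    have : (M : ℝ) * Real.log 2 ≤ 0 := mul_nonpos_of_nonpos_of_nonneg (not_lt.mp h) hl.le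
    linarith
  have hst := Stirling.le_factorial_stirling M
  have hsq : √x ≤ √(2 * Real.pi * M) := by
    apply Real.sqrt_le_sqrt
    have := Real.pi_gt_three
    nlinarith
  have hsx : 0 < √x := Real.sqrt_pos.mpr (by linarith)
  have hfac : √x * (M / Real.exp 1) ^ M ≤ (M.factorial : ℝ) :=
    (mul_le_mul_of_nonneg_right hsq (by positivity)).trans hst
  have hδ := one_add_log_log_two_mem
  have hexp : (Real.exp 1 * Real.log 2) ^ M ≤ Real.exp 1 * Real.exp (x * (1 - fordDelta)) := by
    have : Real.exp 1 * Real.log 2 = Real.exp (1 + Real.log (Real.log 2)) := by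
      rw [Real.exp_add, Real.exp_log hl]
    rw [this, ← Real.exp_nat_mul, ← Real.exp_add]
    apply Real.exp_le_exp.mpr
    have h3 : x * (1 - fordDelta) = x / Real.log 2 * (1 + Real.log (Real.log 2)) := by
      rw [← fordDelta_eq]; field_simp
    rw [h3]
    nlinarith
  rw [div_le_div_iff₀ (by positivity) hsx]
  calc x ^ M * √x ≤ (M * Real.log 2) ^ M * √x := by gcongr
    _ = (Real.exp 1 * Real.log 2) ^ M * (√x * (M / Real.exp 1) ^ M) := by
        rw [mul_pow, mul_pow, div_pow]; field_simp
    _ ≤ _ := by gcongr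

lemma ceil_div_log_two_le {x : ℝ} (hx : 1 ≤ x) : (⌈x / Real.log 2⌉₊ : ℝ) ≤ 3 * x := by
  have h1 := half_lt_log_two
  have hMx' : (⌈x / Real.log 2⌉₊ : ℝ) < x / Real.log 2 + 1 := Nat.ceil_lt_add_one (by positivity)
  have : x / Real.log 2 ≤ 3 / 2 * x := by
    rw [div_le_iff₀ (by linarith)]; nlinarith
  linarith

lemma ceil_div_log_two_pos {x : ℝ} (hx : 1 ≤ x) : 0 < ⌈x / Real.log 2⌉₊ := by
  have h1 := half_lt_log_two
  have : 0 < x / Real.log 2 := by positivity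
  exact Nat.ceil_pos.mpr this

lemma pow_div_factorial_pred_le {x : ℝ} (hx : 1 ≤ x) {M : ℕ} (hM : 0 < M) (hMx : (M : ℝ) ≤ 3 * x) :
    x ^ (M - 1) / ((M - 1).factorial : ℝ) ≤ 3 * (x ^ M / (M.factorial : ℝ)) := by
  obtain ⟨m, rfl⟩ : ∃ m, M = m + 1 := ⟨M - 1, by omega⟩
  rw [Nat.add_sub_cancel, Nat.factorial_succ, pow_succ]
  have : (0 : ℝ) < m.factorial := by positivity
  push_cast at hMx ⊢
  have hm : (0 : ℝ) < (m : ℝ) + 1 := by positivity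
  rw [div_le_iff₀ this]
  have h2 : 3 * (x ^ m * x / (((m : ℝ) + 1) * m.factorial)) * m.factorial
      = x ^ m * (3 * x / (m + 1)) := by
    field_simp
  rw [h2]
  have : 1 ≤ 3 * x / ((m : ℝ) + 1) := by rw [le_div_iff₀ hm]; linarith
  nlinarith [show 0 < x ^ m by positivity]

/-- Upper tail of the Poisson distribution beyond `x / log 2`. -/
lemma sum_upper_tail_le {x : ℝ} (hx : 1 ≤ x) (B : ℕ) :
    ∑ m ∈ Finset.Ico (⌈x / Real.log 2⌉₊ - 1) B, x ^ m / (m.factorial : ℝ) ≤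
      12 * (Real.exp 1 * Real.exp (x * (1 - fordDelta)) / √x) := by
  have h1 := half_lt_log_two
  have h2 := log_two_lt
  have hl : 0 < Real.log 2 := by linarith
  have hterm := pow_div_factorial_le hx
  have hM3 := ceil_div_log_two_le hx
  have hM0 := ceil_div_log_two_pos hx
  have hMx : x / Real.log 2 ≤ ⌈x / Real.log 2⌉₊ := Nat.le_ceil _
  set M := ⌈x / Real.log 2⌉₊
  have hpred := pow_div_factorial_pred_le hx hM0 hM3
  have hgeom : ∀ i : ℕ, x ^ (M - 1 + i) / ((M - 1 + i).factorial : ℝ) ≤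
      x ^ (M - 1) / ((M - 1).factorial : ℝ) * (7 / 10) ^ i := by
    intro i
    induction i with
    | zero => simp
    | succ i ih =>
      have hr : x / ((M - 1 + i + 1 : ℕ) : ℝ) ≤ 7 / 10 := by
        have : (M : ℝ) ≤ ((M - 1 + i + 1 : ℕ) : ℝ) := by exact_mod_cast (by omega)
        rw [div_le_iff₀ (by positivity)]
        rw [div_le_iff₀ hl] at hMx
        nlinarith
      calc x ^ (M - 1 + (i + 1)) / ((M - 1 + (i + 1)).factorial : ℝ)
          = x ^ (M - 1 + i) / ((M - 1 + i).factorial : ℝ) * (x / ((M - 1 + i + 1 : ℕ) : ℝ)) := by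
            rw [← add_assoc, Nat.factorial_succ, pow_succ]; push_cast; field_simp
        _ ≤ (x ^ (M - 1) / ((M - 1).factorial : ℝ) * (7 / 10) ^ i) * (7 / 10) := by gcongr
        _ = _ := by rw [pow_succ]; ring
  rw [Finset.sum_Ico_eq_sum_range]
  calc ∑ i ∈ Finset.range (B - (M - 1)), x ^ (M - 1 + i) / ((M - 1 + i).factorial : ℝ)
      ≤ ∑ i ∈ Finset.range (B - (M - 1)),
          x ^ (M - 1) / ((M - 1).factorial : ℝ) * (7 / 10) ^ i := Finset.sum_le_sum fun i _ => hgeom i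
    _ = x ^ (M - 1) / ((M - 1).factorial : ℝ) * ∑ i ∈ Finset.range (B - (M - 1)), (7 / 10 : ℝ) ^ i := by
        rw [Finset.mul_sum]
    _ ≤ x ^ (M - 1) / ((M - 1).factorial : ℝ) * 4 := by
        gcongr
        rw [geom_sum_eq (by norm_num)]
        have : (0 : ℝ) < (7 / 10) ^ (B - (M - 1)) := by positivity
        rw [div_le_iff_of_neg (by norm_num)]
        linarith
    _ ≤ _ := by linarith

/-- Lower tail of a Poisson sum with parameter `2 x` below `x / log 2`. -/
lemma sum_lower_tail_le {x : ℝ} (hx : 1 ≤ x) :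
    ∑ m ∈ Finset.range ⌈x / Real.log 2⌉₊, (2 * x) ^ m / (m.factorial : ℝ) ≤
      24 * Real.exp x * (Real.exp 1 * Real.exp (x * (1 - fordDelta)) / √x) := by
  have h1 := half_lt_log_two
  have hl : 0 < Real.log 2 := by linarith
  have hterm := pow_div_factorial_le hx
  have hM3 := ceil_div_log_two_le hx
  have hM0 := ceil_div_log_two_pos hx
  have hMx : (⌈x / Real.log 2⌉₊ : ℝ) < x / Real.log 2 + 1 := Nat.ceil_lt_add_one (by positivity)
  set M := ⌈x / Real.log 2⌉₊
  have hpred := pow_div_factorial_pred_le (x := 2 * x) (by linarith) hM0 (by linarith)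
  have hind : ∀ j : ℕ, j + 1 ≤ M → ∑ m ∈ Finset.range j, (2 * x) ^ m / (m.factorial : ℝ) ≤
      3 * ((2 * x) ^ j / (j.factorial : ℝ)) := by
    intro j
    induction j with
    | zero => intro; simp
    | succ j ih =>
      intro hj
      rw [Finset.sum_range_succ]
      have ih' := ih (by omega)
      have hr : 4 / 3 ≤ 2 * x / ((j + 1 : ℕ) : ℝ) := by
        have h3 : ((j + 1 + 1 : ℕ) : ℝ) ≤ M := by exact_mod_cast hj
        have h4 : x / Real.log 2 ≤ 3 / 2 * x := by
          rw [div_le_iff₀ hl]; nlinarith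
        rw [le_div_iff₀ (by positivity)]
        push_cast at h3 ⊢
        linarith
      have h5 : (2 * x) ^ (j + 1) / ((j + 1).factorial : ℝ)
          = (2 * x) ^ j / (j.factorial : ℝ) * (2 * x / ((j + 1 : ℕ) : ℝ)) := by
        rw [Nat.factorial_succ, pow_succ]; push_cast; field_simp
      have h6 : 0 ≤ (2 * x) ^ j / (j.factorial : ℝ) := by positivity
      rw [h5]
      nlinarith
  have hpow : (2 : ℝ) ^ M ≤ 2 * Real.exp x := by
    calc (2 : ℝ) ^ M = Real.exp (M * Real.log 2) := by
          rw [Real.exp_nat_mul, Real.exp_log (by norm_num)]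
      _ ≤ Real.exp (Real.log 2 + x) := by
          apply Real.exp_le_exp.mpr
          have : x / Real.log 2 * Real.log 2 = x := by field_simp
          nlinarith
      _ = _ := by rw [Real.exp_add, Real.exp_log (by norm_num)]
  have hsum : ∑ m ∈ Finset.range M, (2 * x) ^ m / (m.factorial : ℝ) ≤
      4 * ((2 * x) ^ (M - 1) / ((M - 1).factorial : ℝ)) := by
    have := hind (M - 1) (by omega)
    conv_lhs => rw [show M = (M - 1) + 1 by omega, Finset.sum_range_succ]
    linarith
  calc ∑ m ∈ Finset.range M, (2 * x) ^ m / (m.factorial : ℝ)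
      ≤ 12 * ((2 * x) ^ M / (M.factorial : ℝ)) := by linarith
    _ = 12 * (2 ^ M * (x ^ M / (M.factorial : ℝ))) := by rw [mul_pow]; ring
    _ ≤ 12 * ((2 * Real.exp x) * (Real.exp 1 * Real.exp (x * (1 - fordDelta)) / √x)) := by gcongr
    _ = _ := by ring

set_option linter.unusedSectionVars false

section ArithmeticSemigroup

variable {A G : Type*} [Fintype A] [DecidableEq A] [CommGroup G] [DecidableEq G]

/-- The degree of the formal product `∏ P ^ v P`. -/
def wt (d : A → ℕ) (v : A → ℕ) : ℕ := ∑ P, v P * d P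

/-- The value at the formal product `∏ P ^ v P` of the completely multiplicative extension of `c`. -/
def ev (c : A → G) (v : A → ℕ) : G := ∏ P, c P ^ v P

/-- Exponent vectors with entries at most `N`. -/
def box (A : Type*) [Fintype A] [DecidableEq A] (N : ℕ) : Finset (A → ℕ) :=
  Fintype.piFinset fun _ => Finset.range (N + 1)

/-- Exponent vectors of degree `m` and value `a`. -/
def fib (d : A → ℕ) (c : A → G) (N m : ℕ) (a : G) : Finset (A → ℕ) :=
  (box A N).filter fun v => wt d v = m ∧ ev c v = a

/-- Prime powers `P ^ j` of degree `r` and value `b`. -/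
def primePowers (d : A → ℕ) (c : A → G) (N r : ℕ) (b : G) : Finset (A × ℕ) :=
  (Finset.univ ×ˢ Finset.Icc 1 N).filter fun x => x.2 * d x.1 = r ∧ c x.1 ^ x.2 = b

/-- The Chebyshev function in degree `r` and class `b`. -/
def chebyshev (d : A → ℕ) (c : A → G) (N r : ℕ) (b : G) : ℝ :=
  ∑ x ∈ primePowers d c N r b, (d x.1 : ℝ)

lemma mem_box {N : ℕ} {v : A → ℕ} : v ∈ box A N ↔ ∀ P, v P ≤ N := by
  simp [box]

lemma wt_add (d : A → ℕ) (u v : A → ℕ) : wt d (u + v) = wt d u + wt d v := by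
  simp [wt, add_mul, Finset.sum_add_distrib]

lemma ev_add (c : A → G) (u v : A → ℕ) : ev c (u + v) = ev c u * ev c v := by
  simp [ev, pow_add, Finset.prod_mul_distrib]

lemma wt_single (d : A → ℕ) (P : A) (j : ℕ) : wt d (Pi.single P j) = j * d P := by
  unfold wt
  rw [Finset.sum_eq_single P]
  · simp
  · intro b _ hb; simp [Pi.single_eq_of_ne hb]
  · simp

lemma ev_single (c : A → G) (P : A) (j : ℕ) : ev c (Pi.single P j) = c P ^ j := by
  unfold ev
  rw [Finset.prod_eq_single P]
  · simp
  · intro b _ hb; simp [Pi.single_eq_of_ne hb]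
  · simp

lemma le_wt {d : A → ℕ} (hd : ∀ P, 1 ≤ d P) (v : A → ℕ) (P : A) : v P ≤ wt d v :=
  (Nat.le_mul_of_pos_right _ (hd P)).trans
    (Finset.single_le_sum (f := fun P => v P * d P) (fun _ _ => Nat.zero_le _) (Finset.mem_univ P))

lemma mem_box_of_wt_le {d : A → ℕ} (hd : ∀ P, 1 ≤ d P) {N : ℕ} {v : A → ℕ} (h : wt d v ≤ N) :
    v ∈ box A N :=
  mem_box.mpr fun P => (le_wt hd v P).trans h

lemma wt_eq_sum_primePowers (d : A → ℕ) {N : ℕ} {v : A → ℕ} (hv : v ∈ box A N) :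
    (wt d v : ℝ) =
      ∑ x ∈ (Finset.univ : Finset A) ×ˢ Finset.Icc 1 N, if x.2 ≤ v x.1 then (d x.1 : ℝ) else 0 := by
  rw [mem_box] at hv
  rw [Finset.sum_product]
  unfold wt
  push_cast
  refine Finset.sum_congr rfl fun P _ => ?_
  rw [← Finset.sum_filter]
  have : (Finset.Icc 1 N).filter (fun j => j ≤ v P) = Finset.Icc 1 (v P) := by
    ext j
    have := hv P
    simp only [Finset.mem_filter, Finset.mem_Icc]
    omega
  rw [this]
  simp

/-- Summation over `v` of the identity `deg v = ∑_{P ^ j ∣ v} deg P`. -/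
lemma degree_mul_sum_fib {d : A → ℕ} (hd : ∀ P, 1 ≤ d P) (c : A → G) {N m : ℕ} (hm : m ≤ N) (a : G)
    (F : (A → ℕ) → ℝ) :
    (m : ℝ) * ∑ v ∈ fib d c N m a, F v =
      ∑ u ∈ (box A N).filter (fun u => wt d u < m),
        ∑ x ∈ primePowers d c N (m - wt d u) (a / ev c u),
          (d x.1 : ℝ) * F (u + Pi.single x.1 x.2) := by
  have hL : (m : ℝ) * ∑ v ∈ fib d c N m a, F v =
      ∑ v ∈ fib d c N m a, ∑ x ∈ (Finset.univ : Finset A) ×ˢ Finset.Icc 1 N,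
        if x.2 ≤ v x.1 then (d x.1 : ℝ) * F v else 0 := by
    rw [Finset.mul_sum]
    refine Finset.sum_congr rfl fun v hv => ?_
    obtain ⟨hv1, hv2, -⟩ := Finset.mem_filter.mp hv
    rw [← hv2, wt_eq_sum_primePowers d hv1, Finset.sum_mul]
    refine Finset.sum_congr rfl fun x _ => ?_
    split_ifs <;> simp
  rw [hL, Finset.sum_comm]
  unfold primePowers
  simp_rw [Finset.sum_filter (s := (Finset.univ : Finset A) ×ˢ Finset.Icc 1 N)]
  rw [Finset.sum_comm (s := (box A N).filter (fun u => wt d u < m))]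
  refine Finset.sum_congr rfl fun x hx => ?_
  rw [← Finset.sum_filter, ← Finset.sum_filter]
  have hx1 : 1 ≤ x.2 := by simp at hx; exact hx.1
  have hxd : 1 ≤ x.2 * d x.1 := Nat.mul_pos hx1 (hd _)
  have hsub : ∀ v : A → ℕ, x.2 ≤ v x.1 → v - Pi.single x.1 x.2 + Pi.single x.1 x.2 = v := by
    intro v hv
    funext P
    by_cases hP : P = x.1
    · subst hP; simp [hv]
    · simp [Pi.single_eq_of_ne hP]
  refine Finset.sum_nbij' (fun v => v - Pi.single x.1 x.2) (fun u => u + Pi.single x.1 x.2)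
    ?_ ?_ ?_ ?_ ?_
  · intro v hv
    simp only [fib, Finset.mem_filter] at hv ⊢
    obtain ⟨⟨hv1, hv2, hv3⟩, hv4⟩ := hv
    have h1 := hsub v hv4
    have h2 : wt d (v - Pi.single x.1 x.2) + x.2 * d x.1 = m := by
      rw [← wt_single d, ← wt_add, h1, hv2]
    have h3 : ev c (v - Pi.single x.1 x.2) * c x.1 ^ x.2 = a := by
      rw [← ev_single c, ← ev_add, h1, hv3]
    refine ⟨⟨mem_box_of_wt_le hd (by omega), by omega⟩, by omega, ?_⟩
    rw [← h3]; simp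
  · intro u hu
    simp only [fib, Finset.mem_filter] at hu ⊢
    obtain ⟨⟨hu1, hu2⟩, hu3, hu4⟩ := hu
    have h2 : wt d (u + Pi.single x.1 x.2) = m := by
      rw [wt_add, wt_single]; omega
    refine ⟨⟨mem_box_of_wt_le hd (by omega), h2, ?_⟩, by simp⟩
    rw [ev_add, ev_single, hu4]; simp
  · intro v hv
    exact hsub v (Finset.mem_filter.mp hv).2
  · intro u _
    funext P; simp
  · intro v hv
    rw [hsub v (Finset.mem_filter.mp hv).2]

variable [Fintype G]

lemma filter_wt_eq_biUnion (d : A → ℕ) (c : A → G) (N m : ℕ) (f : (A → ℕ) → ℝ) :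
    ∑ u ∈ (box A N).filter (fun u => wt d u = m), f u = ∑ b, ∑ u ∈ fib d c N m b, f u := by
  rw [← Finset.sum_fiberwise (s := (box A N).filter (fun u => wt d u = m)) (g := ev c)]
  refine Finset.sum_congr rfl fun b _ => ?_
  rw [Finset.filter_filter]
  rfl

lemma sum_filter_wt_lt (d : A → ℕ) (c : A → G) (N m : ℕ) (f : (A → ℕ) → ℝ) :
    ∑ u ∈ (box A N).filter (fun u => wt d u < m), f u =
      ∑ r ∈ Finset.range m, ∑ b, ∑ u ∈ fib d c N r b, f u := by
  simp_rw [← filter_wt_eq_biUnion]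
  rw [← Finset.sum_fiberwise_of_maps_to (s := (box A N).filter (fun u => wt d u < m))
    (t := Finset.range m) (g := wt d)]
  · refine Finset.sum_congr rfl fun r hr => ?_
    rw [Finset.filter_filter]
    refine Finset.sum_congr ?_ fun _ _ => rfl
    ext u
    simp only [Finset.mem_filter, Finset.mem_range] at hr ⊢
    constructor
    · rintro ⟨h1, -, h3⟩; exact ⟨h1, h3⟩
    · rintro ⟨h1, h3⟩; exact ⟨h1, h3 ▸ hr, h3⟩
  · intro u hu
    simpa using (Finset.mem_filter.mp hu).2

lemma fib_zero {d : A → ℕ} (hd : ∀ P, 1 ≤ d P) (c : A → G) (N : ℕ) (b : G) :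
    fib d c N 0 b = if b = 1 then {0} else ∅ := by
  have h0 : ev c 0 = 1 := by simp [ev]
  ext v
  have hv : wt d v = 0 ↔ v = 0 := by
    constructor
    · intro h
      funext P
      have := le_wt hd v P
      simp; omega
    · rintro rfl; simp [wt]
  simp only [fib, Finset.mem_filter, hv]
  split_ifs with hb
  · subst hb
    simp only [Finset.mem_singleton]
    constructor
    · rintro ⟨-, h, -⟩; exact h
    · rintro rfl; exact ⟨mem_box.mpr (by simp), rfl, h0⟩
  · simp only [Finset.notMem_empty, iff_false, not_and]
    rintro - rfl h
    exact hb (h ▸ h0)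

/-- Exact equidistribution in every degree forces the Chebyshev function to be exactly
`(q ^ m - (-1) ^ m) / (q + 1)`. -/
lemma chebyshev_eq {d : A → ℕ} (hd : ∀ P, 1 ≤ d P) (c : A → G) {N q : ℕ}
    (hG : Fintype.card G = q + 1)
    (hcount : ∀ r, 1 ≤ r → r ≤ N → ∀ b, (fib d c N r b).card = q ^ (r - 1)) :
    ∀ m, 1 ≤ m → m ≤ N → ∀ a,
      ((q : ℝ) + 1) * chebyshev d c N m a = (q : ℝ) ^ m - (-1) ^ m := by
  have hrec : ∀ m, m + 1 ≤ N → ∀ a, ((m + 1 : ℕ) : ℝ) * (q : ℝ) ^ m =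
      chebyshev d c N (m + 1) a +
        ∑ r ∈ Finset.range m, (q : ℝ) ^ r * ∑ b, chebyshev d c N (m - r) b := by
    intro m hm a
    have h := degree_mul_sum_fib hd c hm a (fun _ => (1 : ℝ))
    simp only [mul_one, Finset.sum_const, nsmul_eq_mul] at h
    rw [hcount (m + 1) (by omega) hm a, sum_filter_wt_lt d c, Finset.sum_range_succ'] at h
    simp only [Nat.add_sub_cancel, Nat.cast_pow] at h
    rw [h, add_comm]
    congr 1
    · have : ∀ b, ∑ u ∈ fib d c N 0 b,
          ∑ x ∈ primePowers d c N (m + 1 - wt d u) (a / ev c u), (d x.1 : ℝ) =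
          if b = 1 then chebyshev d c N (m + 1) a else 0 := by
        intro b
        rw [fib_zero hd]
        split_ifs
        · simp [wt, ev, chebyshev]
        · simp
      simp_rw [this]
      simp
    · refine Finset.sum_congr rfl fun r hr => ?_
      rw [Finset.mem_range] at hr
      have : ∀ b, ∑ u ∈ fib d c N (r + 1) b,
          ∑ x ∈ primePowers d c N (m + 1 - wt d u) (a / ev c u), (d x.1 : ℝ) =
          (q : ℝ) ^ r * chebyshev d c N (m - r) (a / b) := by
        intro b
        have : ∀ u ∈ fib d c N (r + 1) b,
            ∑ x ∈ primePowers d c N (m + 1 - wt d u) (a / ev c u), (d x.1 : ℝ) =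
            chebyshev d c N (m - r) (a / b) := by
          intro u hu
          obtain ⟨-, h2, h3⟩ := Finset.mem_filter.mp hu
          rw [h2, h3, show m + 1 - (r + 1) = m - r by omega]
          rfl
        rw [Finset.sum_congr rfl this, Finset.sum_const, hcount (r + 1) (by omega) (by omega)]
        simp
      simp_rw [this]
      rw [← Finset.mul_sum]
      congr 1
      exact Fintype.sum_equiv (Equiv.divLeft a) _ _ (fun b => rfl)
  have hind : ∀ m a b, m + 1 ≤ N → chebyshev d c N (m + 1) a = chebyshev d c N (m + 1) b := by
    intro m a b hm
    have h1 := hrec m hm a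
    have h2 := hrec m hm b
    linarith
  have hsum : ∀ m, 1 ≤ m → m ≤ N →
      ∑ b, chebyshev d c N m b = ((q : ℝ) + 1) * chebyshev d c N m 1 := by
    intro m hm1 hm
    obtain ⟨m, rfl⟩ : ∃ l, m = l + 1 := ⟨m - 1, by omega⟩
    rw [Finset.sum_congr rfl fun b _ => hind m b 1 hm]
    simp [hG]
  have hstep : ∀ m, m + 1 + 1 ≤ N →
      chebyshev d c N (m + 1 + 1) 1 + chebyshev d c N (m + 1) 1 = (q : ℝ) ^ (m + 1) := by
    intro m hm
    have h1 := hrec (m + 1) hm 1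
    have h2 := hrec m (by omega) 1
    rw [Finset.sum_range_succ'] at h1
    have h3 : ∑ r ∈ Finset.range m, (q : ℝ) ^ (r + 1) * ∑ b, chebyshev d c N (m + 1 - (r + 1)) b
        = q * ∑ r ∈ Finset.range m, (q : ℝ) ^ r * ∑ b, chebyshev d c N (m - r) b := by
      rw [Finset.mul_sum]
      refine Finset.sum_congr rfl fun r _ => ?_
      rw [show m + 1 - (r + 1) = m - r by omega]
      ring
    rw [h3, Nat.sub_zero, hsum (m + 1) (by omega) (by omega)] at h1
    have h4 : ∑ r ∈ Finset.range m, (q : ℝ) ^ r * ∑ b, chebyshev d c N (m - r) b =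
        ((m + 1 : ℕ) : ℝ) * (q : ℝ) ^ m - chebyshev d c N (m + 1) 1 := by linarith
    rw [h4] at h1
    push_cast at h1
    rw [pow_succ] at h1 ⊢
    linear_combination -h1
  intro m hm1 hm a
  obtain ⟨m, rfl⟩ : ∃ l, m = l + 1 := ⟨m - 1, by omega⟩
  rw [hind m a 1 hm]
  clear hm1
  induction m with
  | zero =>
    have := hrec 0 hm 1
    simp at this
    rw [zero_add, ← this]; simp
  | succ m ih =>
    have h1 := ih (by omega)
    have h2 := hstep m hm
    have h3 : chebyshev d c N (m + 1 + 1) 1 = (q : ℝ) ^ (m + 1) - chebyshev d c N (m + 1) 1 := by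
      linarith
    rw [h3, mul_sub, h1]
    ring

lemma chebyshev_le {d : A → ℕ} (hd : ∀ P, 1 ≤ d P) (c : A → G) {N q : ℕ} (hq : 2 ≤ q)
    (hG : Fintype.card G = q + 1)
    (hcount : ∀ r, 1 ≤ r → r ≤ N → ∀ b, (fib d c N r b).card = q ^ (r - 1))
    {m : ℕ} (hm1 : 1 ≤ m) (hm : m ≤ N) (a : G) : chebyshev d c N m a ≤ (q : ℝ) ^ (m - 1) := by
  have h := chebyshev_eq hd c hG hcount m hm1 hm a
  obtain ⟨m, rfl⟩ : ∃ l, m = l + 1 := ⟨m - 1, by omega⟩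
  have hq' : (2 : ℝ) ≤ q := by exact_mod_cast hq
  have h1 : (1 : ℝ) ≤ (q : ℝ) ^ m := one_le_pow₀ (by linarith)
  have h2 : -(-1 : ℝ) ^ (m + 1) ≤ 1 := by
    rcases neg_one_pow_eq_or ℝ (m + 1) with h | h <;> rw [h] <;> norm_num
  simp only [Nat.add_sub_cancel]
  rw [pow_succ (q : ℝ)] at h
  have : ((q : ℝ) + 1) * chebyshev d c N (m + 1) a ≤ (q + 1) * (q : ℝ) ^ m := by linarith
  exact le_of_mul_le_mul_left this (by linarith)

/-- The prime polynomial bound. -/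
lemma mul_card_filter_degree_le {d : A → ℕ} (hd : ∀ P, 1 ≤ d P) (c : A → G) {N q : ℕ} (hq : 2 ≤ q)
    (hG : Fintype.card G = q + 1)
    (hcount : ∀ r, 1 ≤ r → r ≤ N → ∀ b, (fib d c N r b).card = q ^ (r - 1))
    {m : ℕ} (hm1 : 1 ≤ m) (hm : m ≤ N) :
    (m : ℝ) * ((Finset.univ.filter fun P => d P = m).card : ℝ) ≤ (q : ℝ) ^ m + 1 := by
  have hq' : (2 : ℝ) ≤ q := by exact_mod_cast hq
  have h1 : ∑ b, chebyshev d c N m b = (q : ℝ) ^ m - (-1) ^ m := by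
    have h : ∀ b ∈ Finset.univ, chebyshev d c N m b = ((q : ℝ) ^ m - (-1) ^ m) / (q + 1) := by
      intro b _
      rw [eq_div_iff (by linarith), mul_comm]
      exact chebyshev_eq hd c hG hcount m hm1 hm b
    rw [Finset.sum_congr rfl h, Finset.sum_const, Finset.card_univ, hG, nsmul_eq_mul]
    push_cast
    field_simp
  have h2 : -(-1 : ℝ) ^ m ≤ 1 := by
    rcases neg_one_pow_eq_or ℝ m with h | h <;> rw [h] <;> norm_num
  have h3 : (m : ℝ) * ((Finset.univ.filter fun P => d P = m).card : ℝ) ≤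
      ∑ b, chebyshev d c N m b := by
    have : ∀ b, ∑ P ∈ (Finset.univ.filter fun P => d P = m).filter (fun P => c P = b), (m : ℝ) ≤
        chebyshev d c N m b := by
      intro b
      unfold chebyshev
      calc ∑ P ∈ (Finset.univ.filter fun P => d P = m).filter (fun P => c P = b), (m : ℝ)
          = ∑ x ∈ ((Finset.univ.filter fun P => d P = m).filter (fun P => c P = b)).image
              (fun P => (P, 1)), (d x.1 : ℝ) := by
            rw [Finset.sum_image (by intro x _ y _ h; simpa using h)]
            refine Finset.sum_congr rfl fun P hP => ?_
            simp only [Finset.mem_filter] at hP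
            simp [hP.1.2]
        _ ≤ _ := by
            refine Finset.sum_le_sum_of_subset_of_nonneg ?_ (fun _ _ _ => Nat.cast_nonneg _)
            intro x hx
            simp only [Finset.mem_image, Finset.mem_filter, Finset.mem_univ, true_and] at hx
            obtain ⟨P, ⟨hP1, hP2⟩, rfl⟩ := hx
            simp only [primePowers, Finset.mem_filter, Finset.mem_product, Finset.mem_univ,
              Finset.mem_Icc, true_and]
            refine ⟨⟨le_rfl, by omega⟩, by simpa using hP1, by simpa using hP2⟩
    calc (m : ℝ) * ((Finset.univ.filter fun P => d P = m).card : ℝ)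
        = ∑ P ∈ (Finset.univ.filter fun P => d P = m), (m : ℝ) := by
          rw [Finset.sum_const, nsmul_eq_mul, mul_comm]
      _ = ∑ b, ∑ P ∈ (Finset.univ.filter fun P => d P = m).filter (fun P => c P = b), (m : ℝ) :=
          (Finset.sum_fiberwise _ _ _).symm
      _ ≤ _ := Finset.sum_le_sum fun b _ => this b
  linarith

/-- Removing one prime power bounds a sum over a degree and class by a logarithmic sum. -/
lemma degree_mul_sum_fib_le {d : A → ℕ} (hd : ∀ P, 1 ≤ d P) (c : A → G) {N q : ℕ} (hq : 2 ≤ q)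
    (hG : Fintype.card G = q + 1)
    (hcount : ∀ r, 1 ≤ r → r ≤ N → ∀ b, (fib d c N r b).card = q ^ (r - 1))
    {m : ℕ} (hm : m ≤ N) (a : G) (F F' : (A → ℕ) → ℝ) (hF' : ∀ u, 0 ≤ F' u)
    (hFF' : ∀ u P j, F (u + Pi.single P j) ≤ F' u) :
    (m : ℝ) * ∑ v ∈ fib d c N m a, F v ≤
      (q : ℝ) ^ (m - 1) *
        ∑ u ∈ (box A N).filter (fun u => wt d u < m), F' u * ((q : ℝ) ^ wt d u)⁻¹ := by
  have hq' : (2 : ℝ) ≤ q := by exact_mod_cast hq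
  rw [degree_mul_sum_fib hd c hm a F, Finset.mul_sum]
  refine Finset.sum_le_sum fun u hu => ?_
  have hu2 := (Finset.mem_filter.mp hu).2
  calc ∑ x ∈ primePowers d c N (m - wt d u) (a / ev c u), (d x.1 : ℝ) * F (u + Pi.single x.1 x.2)
      ≤ ∑ x ∈ primePowers d c N (m - wt d u) (a / ev c u), (d x.1 : ℝ) * F' u :=
        Finset.sum_le_sum fun x _ => mul_le_mul_of_nonneg_left (hFF' _ _ _) (Nat.cast_nonneg _)
    _ = chebyshev d c N (m - wt d u) (a / ev c u) * F' u := by rw [chebyshev, Finset.sum_mul]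
    _ ≤ (q : ℝ) ^ (m - wt d u - 1) * F' u :=
        mul_le_mul_of_nonneg_right
          (chebyshev_le hd c hq hG hcount (by omega) (by omega) _) (hF' u)
    _ = _ := by
        have : (q : ℝ) ^ (m - 1) = (q : ℝ) ^ (m - wt d u - 1) * (q : ℝ) ^ wt d u := by
          rw [← pow_add]; congr 1; omega
        rw [this]
        field_simp

lemma degree_mul_sum_filter_le {d : A → ℕ} (hd : ∀ P, 1 ≤ d P) (c : A → G) {N q : ℕ} (hq : 2 ≤ q)
    (hG : Fintype.card G = q + 1)
    (hcount : ∀ r, 1 ≤ r → r ≤ N → ∀ b, (fib d c N r b).card = q ^ (r - 1))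
    {m : ℕ} (hm1 : 1 ≤ m) (hm : m ≤ N) (F F' : (A → ℕ) → ℝ) (hF' : ∀ u, 0 ≤ F' u)
    (hFF' : ∀ u P j, F (u + Pi.single P j) ≤ F' u) :
    (m : ℝ) * ∑ v ∈ (box A N).filter (fun v => wt d v = m), F v ≤
      2 * (q : ℝ) ^ m *
        ∑ u ∈ (box A N).filter (fun u => wt d u < m), F' u * ((q : ℝ) ^ wt d u)⁻¹ := by
  have hq' : (2 : ℝ) ≤ q := by exact_mod_cast hq
  rw [filter_wt_eq_biUnion d c, Finset.mul_sum]
  refine (Finset.sum_le_sum fun b _ =>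
    degree_mul_sum_fib_le hd c hq hG hcount hm b F F' hF' hFF').trans ?_
  rw [Finset.sum_const, Finset.card_univ, hG, nsmul_eq_mul, ← mul_assoc]
  refine mul_le_mul_of_nonneg_right ?_
    (Finset.sum_nonneg fun u _ => mul_nonneg (hF' u) (by positivity))
  obtain ⟨m, rfl⟩ : ∃ l, m = l + 1 := ⟨m - 1, by omega⟩
  rw [Nat.add_sub_cancel, pow_succ]
  push_cast
  have : 0 < (q : ℝ) ^ m := by positivity
  nlinarith

end ArithmeticSemigroup

section EulerProduct

lemma pow_succ_add_mul_le {x y : ℝ} (hx : 0 ≤ x) (hy : 0 ≤ y) (m : ℕ) :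
    x ^ (m + 1) + (m + 1) * (y * x ^ m) ≤ (x + y) ^ (m + 1) := by
  induction m with
  | zero => simp
  | succ m ih =>
    have h1 : 0 ≤ y * x ^ m := by positivity
    have h2 := mul_le_mul_of_nonneg_right ih (add_nonneg hx hy)
    rw [pow_succ (x + y)]
    refine le_trans ?_ h2
    push_cast
    have h3 : 0 ≤ (m + 1) * (y * x ^ m) * y := by positivity
    rw [pow_succ x (m + 1), pow_succ x m]
    nlinarith

lemma pow_div_factorial_add_le {x y : ℝ} (hx : 0 ≤ x) (hy : 0 ≤ y) (m : ℕ) :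
    x ^ (m + 1) / ((m + 1).factorial : ℝ) + y * (x ^ m / (m.factorial : ℝ)) ≤
      (x + y) ^ (m + 1) / ((m + 1).factorial : ℝ) := by
  have h := pow_succ_add_mul_le hx hy m
  have hf : (0 : ℝ) < m.factorial := by positivity
  rw [Nat.factorial_succ]
  push_cast
  have h1 : y * (x ^ m / (m.factorial : ℝ)) =
      ((m + 1) * (y * x ^ m)) / (((m : ℝ) + 1) * m.factorial) := by
    field_simp
  rw [h1, ← add_div]
  gcongr

variable {A : Type*} [DecidableEq A]

/-- Coefficients of a product of constants and linear polynomials. -/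
lemma coeff_prod_le (small : Finset A) (α β : A → ℝ) (y D : A → ℝ)
    (hα : ∀ P, 0 ≤ α P) (hβ : ∀ P, 0 ≤ β P)
    (h1 : ∀ P ∈ small, α P ≤ 1) (hy : ∀ P ∈ small, β P ≤ y P)
    (hβ0 : ∀ P ∉ small, β P = 0) (hD : ∀ P ∉ small, α P ≤ D P) (s : Finset A) :
    ∀ m, 0 ≤ (∏ P ∈ s, (C (α P) + C (β P) * X)).coeff m ∧
      (∏ P ∈ s, (C (α P) + C (β P) * X)).coeff m ≤
      (∏ P ∈ s.filter (fun P => P ∉ small), D P) *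
        ((∑ P ∈ s.filter (fun P => P ∈ small), y P) ^ m / (m.factorial : ℝ)) := by
  induction s using Finset.induction_on with
  | empty =>
    intro m
    rcases m with _ | m <;> simp [coeff_one]
  | insert P s hP ih =>
    intro m
    rw [Finset.prod_insert hP, add_mul]
    have hY : 0 ≤ ∑ P ∈ s.filter (fun P => P ∈ small), y P :=
      Finset.sum_nonneg fun Q hQ => (hβ Q).trans (hy Q (Finset.mem_filter.mp hQ).2)
    have hDD : 0 ≤ ∏ P ∈ s.filter (fun P => P ∉ small), D P :=
      Finset.prod_nonneg fun Q hQ => (hα Q).trans (hD Q (Finset.mem_filter.mp hQ).2)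
    by_cases hs : P ∈ small
    · rw [Finset.filter_insert, if_neg (by simpa using hs), Finset.filter_insert, if_pos hs,
        Finset.sum_insert (by simp [hP])]
      have hyP : 0 ≤ y P := (hβ P).trans (hy P hs)
      rcases m with _ | m
      · have := ih 0
        simp only [coeff_add, mul_coeff_zero, coeff_C_zero, coeff_X_zero, mul_zero, zero_mul,
          add_zero, pow_zero] at this ⊢
        refine ⟨mul_nonneg (hα P) this.1, le_trans ?_ this.2⟩
        exact mul_le_of_le_one_left this.1 (h1 P hs)
      · have i1 := ih (m + 1)
        have i2 := ih m
        rw [coeff_add, coeff_C_mul, mul_assoc, coeff_C_mul, coeff_X_mul]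
        refine ⟨add_nonneg (mul_nonneg (hα P) i1.1) (mul_nonneg (hβ P) i2.1), ?_⟩
        have hb := pow_div_factorial_add_le hY hyP m
        calc _ ≤ 1 * (∏ P ∈ s, (C (α P) + C (β P) * X)).coeff (m + 1) +
              y P * (∏ P ∈ s, (C (α P) + C (β P) * X)).coeff m :=
              add_le_add (mul_le_mul_of_nonneg_right (h1 P hs) i1.1)
                (mul_le_mul_of_nonneg_right (hy P hs) i2.1)
          _ ≤ 1 * ((∏ P ∈ s.filter (fun P => P ∉ small), D P) *
                ((∑ P ∈ s.filter (fun P => P ∈ small), y P) ^ (m + 1) /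
                  ((m + 1).factorial : ℝ))) +
              y P * ((∏ P ∈ s.filter (fun P => P ∉ small), D P) *
                ((∑ P ∈ s.filter (fun P => P ∈ small), y P) ^ m / (m.factorial : ℝ))) :=
              add_le_add (mul_le_mul_of_nonneg_left i1.2 zero_le_one)
                (mul_le_mul_of_nonneg_left i2.2 hyP)
          _ = (∏ P ∈ s.filter (fun P => P ∉ small), D P) *
                ((∑ P ∈ s.filter (fun P => P ∈ small), y P) ^ (m + 1) /
                  ((m + 1).factorial : ℝ) + y P *
                ((∑ P ∈ s.filter (fun P => P ∈ small), y P) ^ m / (m.factorial : ℝ))) := by ring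
          _ ≤ _ := by
              rw [add_comm (y P)]
              exact mul_le_mul_of_nonneg_left hb hDD
    · rw [Finset.filter_insert, if_pos hs, Finset.filter_insert, if_neg hs,
        Finset.prod_insert (by simp [hP]), hβ0 P hs]
      have := ih m
      simp only [map_zero, zero_mul, add_zero, coeff_C_mul]
      refine ⟨mul_nonneg (hα P) this.1, ?_⟩
      rw [mul_assoc]
      exact mul_le_mul (hD P hs) this.2 this.1 ((hα P).trans (hD P hs))

variable [Fintype A] {τ : Type*} [DecidableEq τ]

/-- Sums over local choices with exactly `m` nontrivial choices at the primes of `small`. -/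
lemma sum_piFinset_le (small : Finset A) (T : A → Finset τ) (z : τ) (w : A → τ → ℝ) (y D : A → ℝ)
    (hw : ∀ P t, 0 ≤ w P t) (h0 : ∀ P ∈ small, w P z ≤ 1)
    (hy : ∀ P ∈ small, ∑ t ∈ (T P).filter (fun t => t ≠ z), w P t ≤ y P)
    (hD : ∀ P ∉ small, ∑ t ∈ T P, w P t ≤ D P) (m : ℕ) :
    ∑ t ∈ (Fintype.piFinset T).filter (fun t => (small.filter fun P => t P ≠ z).card = m),
        ∏ P, w P (t P) ≤
      (∏ P ∈ Finset.univ.filter (fun P => P ∉ small), D P) *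
        ((∑ P ∈ small, y P) ^ m / (m.factorial : ℝ)) := by
  set α : A → ℝ := fun P => if P ∈ small then ∑ t ∈ (T P).filter (fun t => t = z), w P t
    else ∑ t ∈ T P, w P t with hα
  set β : A → ℝ := fun P => if P ∈ small then ∑ t ∈ (T P).filter (fun t => t ≠ z), w P t
    else 0 with hβ
  have hlocal : ∀ P, ∑ t ∈ T P, C (w P t) * X ^ (if P ∈ small ∧ t ≠ z then 1 else 0) =
      C (α P) + C (β P) * X := by
    intro P
    by_cases hP : P ∈ small
    · simp only [hα, hβ, hP, true_and, if_true]
      rw [← Finset.sum_filter_add_sum_filter_not (T P) (fun t => t = z), map_sum, map_sum,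
        Finset.sum_mul]
      congr 1
      · refine Finset.sum_congr rfl fun t ht => ?_
        simp [(Finset.mem_filter.mp ht).2]
      · refine Finset.sum_congr rfl fun t ht => ?_
        rw [if_pos (Finset.mem_filter.mp ht).2, pow_one]
    · simp [hα, hβ, hP, map_sum]
  have hprod : ∏ P, (C (α P) + C (β P) * X) =
      ∑ t ∈ Fintype.piFinset T, C (∏ P, w P (t P)) * X ^ (small.filter fun P => t P ≠ z).card := by
    simp_rw [← hlocal]
    rw [Finset.prod_univ_sum]
    refine Finset.sum_congr rfl fun t _ => ?_
    rw [Finset.prod_mul_distrib, map_prod, Finset.prod_pow_eq_pow_sum, Finset.sum_boole]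
    congr 2
    simp only [Nat.cast_id]
    congr 1
    ext P
    simp
  have hcoeff : (∏ P, (C (α P) + C (β P) * X)).coeff m =
      ∑ t ∈ (Fintype.piFinset T).filter (fun t => (small.filter fun P => t P ≠ z).card = m),
        ∏ P, w P (t P) := by
    rw [hprod, finsetSum_coeff, Finset.sum_filter]
    refine Finset.sum_congr rfl fun t _ => ?_
    rw [coeff_C_mul, coeff_X_pow]
    simp [eq_comm]
  rw [← hcoeff]
  have hα0 : ∀ P, 0 ≤ α P := by
    intro P
    simp only [hα]
    split_ifs <;> exact Finset.sum_nonneg fun _ _ => hw _ _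
  have hβ0 : ∀ P, 0 ≤ β P := by
    intro P
    simp only [hβ]
    split_ifs
    · exact Finset.sum_nonneg fun _ _ => hw _ _
    · exact le_rfl
  have := (coeff_prod_le small α β y D hα0 hβ0 ?_ ?_ ?_ ?_ Finset.univ m).2
  · simpa using this
  · intro P hP
    simp only [hα, if_pos hP]
    rw [Finset.filter_eq']
    split_ifs
    · simpa using h0 P hP
    · simp
  · intro P hP
    simpa only [hβ, if_pos hP] using hy P hP
  · intro P hP
    simp only [hβ, if_neg hP]
  · intro P hP
    simpa only [hα, if_neg hP] using hD P hP

end EulerProduct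

section LocalFactors

lemma sum_range_pow_le {x : ℝ} (hx0 : 0 ≤ x) (hx : x ≤ 1 / 2) (N : ℕ) :
    ∑ j ∈ Finset.range N, x ^ j ≤ 1 + (x + 2 * x ^ 2) := by
  have h := mul_neg_geom_sum x N
  have h1 : 0 ≤ x ^ N := by positivity
  have h2 : 1 ≤ (1 - x) * (1 + (x + 2 * x ^ 2)) := by
    have : 0 ≤ x ^ 2 * (1 - 2 * x) := mul_nonneg (sq_nonneg _) (by linarith)
    nlinarith
  have : (1 - x) * ∑ j ∈ Finset.range N, x ^ j ≤ (1 - x) * (1 + (x + 2 * x ^ 2)) := by linarith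
  exact le_of_mul_le_mul_left this (by linarith)

lemma sum_range_filter_pow_le {x : ℝ} (hx0 : 0 ≤ x) (hx : x ≤ 1 / 2) (N : ℕ) :
    ∑ j ∈ (Finset.range (N + 1)).filter (fun j => j ≠ 0), x ^ j ≤ x + 2 * x ^ 2 := by
  have h := sum_range_pow_le hx0 hx (N + 1)
  rw [← Finset.sum_filter_add_sum_filter_not (Finset.range (N + 1)) (fun j => j = 0)] at h
  have : (Finset.range (N + 1)).filter (fun j => j = 0) = {0} := by
    rw [Finset.filter_eq']; simp
  rw [this] at h
  simpa using h

lemma sum_product_filter_pow_le {x : ℝ} (hx0 : 0 ≤ x) (hx : x ≤ 1 / 2) (N : ℕ) :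
    ∑ t ∈ ((Finset.range (N + 1)) ×ˢ (Finset.range (N + 1))).filter (fun t => t ≠ (0, 0)),
      x ^ t.1 * x ^ t.2 ≤ 2 * x + 12 * x ^ 2 := by
  have h := sum_range_pow_le hx0 hx (N + 1)
  have h0 : 0 ≤ ∑ j ∈ Finset.range (N + 1), x ^ j := Finset.sum_nonneg fun _ _ => by positivity
  have h1 : ∑ t ∈ (Finset.range (N + 1)) ×ˢ (Finset.range (N + 1)), x ^ t.1 * x ^ t.2 =
      (∑ j ∈ Finset.range (N + 1), x ^ j) * ∑ j ∈ Finset.range (N + 1), x ^ j := by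
    rw [Finset.sum_mul_sum, Finset.sum_product]
  rw [← Finset.sum_filter_add_sum_filter_not _ (fun t : ℕ × ℕ => t = (0, 0))] at h1
  have : ((Finset.range (N + 1)) ×ˢ (Finset.range (N + 1))).filter (fun t => t = (0, 0)) =
      {(0, 0)} := by
    rw [Finset.filter_eq']; simp
  rw [this] at h1
  simp only [Finset.sum_singleton, pow_zero, mul_one] at h1
  have h2 := mul_le_mul h h h0 (by positivity)
  have h3 : x ^ 3 ≤ x ^ 2 / 2 := by nlinarith [sq_nonneg x]
  have h4 : x ^ 4 ≤ x ^ 2 / 4 := by nlinarith [sq_nonneg x]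
  nlinarith

/-- Weights `q ^ (-deg)` summed over a range of degrees. -/
lemma sum_degree_le {A : Type*} [Fintype A] {d : A → ℕ} {N q : ℕ} (hq : 2 ≤ q)
    (hcard : ∀ m, 1 ≤ m → m ≤ N →
      (m : ℝ) * ((Finset.univ.filter fun P => d P = m).card : ℝ) ≤ (q : ℝ) ^ m + 1)
    {a b : ℝ} (ha : 0 ≤ a) (hb : 0 ≤ b) (i j : ℕ) (hj : j ≤ N) :
    ∑ P ∈ Finset.univ.filter (fun P => i < d P ∧ d P ≤ j),
        (a * ((q : ℝ) ^ d P)⁻¹ + b * (((q : ℝ) ^ d P)⁻¹) ^ 2) ≤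
      a * ∑ m ∈ Finset.Ioc i j, (1 / m : ℝ) + (a + 2 * b) := by
  have hq' : (2 : ℝ) ≤ q := by exact_mod_cast hq
  have hfib : ∑ P ∈ Finset.univ.filter (fun P => i < d P ∧ d P ≤ j),
        (a * ((q : ℝ) ^ d P)⁻¹ + b * (((q : ℝ) ^ d P)⁻¹) ^ 2) =
      ∑ m ∈ Finset.Ioc i j, ((Finset.univ.filter fun P => d P = m).card : ℝ) *
        (a * ((q : ℝ) ^ m)⁻¹ + b * (((q : ℝ) ^ m)⁻¹) ^ 2) := by
    rw [← Finset.sum_fiberwise_of_maps_to (t := Finset.Ioc i j) (g := d)]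
    · refine Finset.sum_congr rfl fun m hm => ?_
      rw [Finset.filter_filter]
      have : (Finset.univ.filter fun P => (i < d P ∧ d P ≤ j) ∧ d P = m) =
          Finset.univ.filter fun P => d P = m := by
        ext P
        simp only [Finset.mem_filter, Finset.mem_univ, true_and, Finset.mem_Ioc] at hm ⊢
        omega
      rw [this, ← nsmul_eq_mul, ← Finset.sum_const]
      refine Finset.sum_congr rfl fun P hP => ?_
      rw [(Finset.mem_filter.mp hP).2]
    · intro P hP
      simpa using hP
  have hterm : ∀ m ∈ Finset.Ioc i j, ((Finset.univ.filter fun P => d P = m).card : ℝ) *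
        (a * ((q : ℝ) ^ m)⁻¹ + b * (((q : ℝ) ^ m)⁻¹) ^ 2) ≤
      a * (1 / m : ℝ) + (a + 2 * b) * (1 / 2) ^ m := by
    intro m hm
    rw [Finset.mem_Ioc] at hm
    have hm1 : 1 ≤ m := by omega
    have hm1' : (1 : ℝ) ≤ m := by exact_mod_cast hm1
    have hc := hcard m hm1 (by omega)
    set x := ((q : ℝ) ^ m)⁻¹ with hx
    have hqm : 0 < (q : ℝ) ^ m := by positivity
    have hx0 : 0 < x := by positivity
    have hqx : (q : ℝ) ^ m * x = 1 := mul_inv_cancel₀ hqm.ne'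
    have hx2 : x ≤ (1 / 2) ^ m := by
      rw [hx, one_div, inv_pow]
      gcongr
    have hxh : x ≤ 1 := hx2.trans (pow_le_one₀ (by norm_num) (by norm_num))
    have hN : ((Finset.univ.filter fun P => d P = m).card : ℝ) ≤ ((q : ℝ) ^ m + 1) / m := by
      rw [le_div_iff₀ (by linarith)]; linarith
    have e1 : (q ^ m + 1) / m * (a * x + b * x ^ 2) =
        (1 / m : ℝ) * (a + (a + b) * x + b * x ^ 2) := by
      have : ((q : ℝ) ^ m + 1) * (a * x + b * x ^ 2) = a + (a + b) * x + b * x ^ 2 := by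
        linear_combination (a + b * x) * hqx
      rw [← this]; ring
    have e2 : (1 / m : ℝ) ≤ 1 := by rw [div_le_one (by linarith)]; exact hm1'
    have e3 : 0 < (1 / m : ℝ) := by positivity
    have e4 : (a + b) * x + b * x ^ 2 ≤ (a + 2 * b) * (1 / 2) ^ m := by
      have : b * x ^ 2 ≤ b * x := mul_le_mul_of_nonneg_left (by nlinarith) hb
      have : (a + 2 * b) * x ≤ (a + 2 * b) * (1 / 2) ^ m :=
        mul_le_mul_of_nonneg_left hx2 (by linarith)
      linarith
    have e5 : 0 ≤ (a + b) * x + b * x ^ 2 := by positivity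
    calc _ ≤ ((q : ℝ) ^ m + 1) / m * (a * x + b * x ^ 2) :=
          mul_le_mul_of_nonneg_right hN (by positivity)
      _ = (1 / m : ℝ) * (a + (a + b) * x + b * x ^ 2) := e1
      _ ≤ _ := by nlinarith
  rw [hfib]
  refine (Finset.sum_le_sum hterm).trans ?_
  rw [Finset.sum_add_distrib, ← Finset.mul_sum, ← Finset.mul_sum]
  have hgeo : ∑ m ∈ Finset.Ioc i j, (1 / 2 : ℝ) ^ m ≤ 1 := by
    calc ∑ m ∈ Finset.Ioc i j, (1 / 2 : ℝ) ^ m ≤ ∑ m ∈ Finset.Ico 1 (j + 1), (1 / 2 : ℝ) ^ m := by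
          refine Finset.sum_le_sum_of_subset_of_nonneg ?_ fun _ _ _ => by positivity
          intro m hm
          simp at hm ⊢
          omega
      _ ≤ 1 := by
          rw [Finset.sum_Ico_eq_sum_range]
          have : ∀ l, ∑ m ∈ Finset.range l, (1 / 2 : ℝ) ^ (1 + m) = 1 - (1 / 2) ^ l := by
            intro l
            induction l with
            | zero => simp
            | succ l ih => rw [Finset.sum_range_succ, ih]; ring
          rw [this]
          have : (0 : ℝ) < (1 / 2) ^ (j + 1 - 1) := by positivity
          linarith
  have : (a + 2 * b) * ∑ m ∈ Finset.Ioc i j, (1 / 2 : ℝ) ^ m ≤ (a + 2 * b) * 1 :=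
    mul_le_mul_of_nonneg_left hgeo (by linarith)
  linarith

lemma sum_Ioc_one_div_le_log {i j : ℕ} (hi : 1 ≤ i) (hij : i ≤ j) :
    ∑ m ∈ Finset.Ioc i j, (1 / m : ℝ) ≤ Real.log j - Real.log i := by
  induction j, hij using Nat.le_induction with
  | base => simp
  | succ j hij ih =>
    rw [Finset.sum_Ioc_succ_top hij]
    have hj : (0 : ℝ) < j := by exact_mod_cast (by omega)
    have h := Real.one_sub_inv_le_log_of_pos (show (0 : ℝ) < (j + 1) / j by positivity)
    rw [Real.log_div (by positivity) (by positivity)] at h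
    have : 1 - ((j + 1 : ℝ) / j)⁻¹ = 1 / (j + 1) := by field_simp; ring
    push_cast
    linarith

lemma sum_Ioc_zero_one_div_le_log {k : ℕ} (hk : 1 ≤ k) :
    ∑ m ∈ Finset.Ioc 0 k, (1 / m : ℝ) ≤ 1 + Real.log k := by
  have h := sum_Ioc_one_div_le_log le_rfl hk
  rw [← Finset.sum_Ioc_consecutive _ (Nat.zero_le 1) hk]
  simp at h ⊢
  linarith

end LocalFactors

section SmallFactors

variable {A : Type*} [Fintype A] [DecidableEq A]

/-- The number of distinct primes of degree at most `k` dividing `v`. -/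
def smallOmega (d : A → ℕ) (k : ℕ) (v : A → ℕ) : ℕ :=
  ((Finset.univ.filter fun P => d P ≤ k).filter fun P => v P ≠ 0).card

lemma smallOmega_mono {d : A → ℕ} (k : ℕ) {u v : A → ℕ} (h : ∀ P, u P ≤ v P) :
    smallOmega d k u ≤ smallOmega d k v := by
  refine Finset.card_le_card fun P => ?_
  have := h P
  simp only [Finset.mem_filter]
  rintro ⟨h1, h2⟩
  exact ⟨h1, by omega⟩

lemma smallOmega_add_single_le (d : A → ℕ) (k : ℕ) (u : A → ℕ) (P : A) (j : ℕ) :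
    smallOmega d k (u + Pi.single P j) ≤ smallOmega d k u + 1 := by
  unfold smallOmega
  rw [← Finset.card_singleton P]
  refine (Finset.card_le_card ?_).trans (Finset.card_union_le _ _)
  intro Q hQ
  simp only [Finset.mem_filter, Finset.mem_union, Finset.mem_singleton] at hQ ⊢
  by_cases h : Q = P
  · exact Or.inr h
  · left
    simpa [Pi.single_eq_of_ne h] using hQ

lemma smallOmega_le_card (d : A → ℕ) (k : ℕ) (u : A → ℕ) : smallOmega d k u ≤ Fintype.card A :=
  Finset.card_le_univ _

lemma prod_inv_pow (d : A → ℕ) (q : ℕ) (v : A → ℕ) :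
    ∏ P, (((q : ℝ) ^ d P)⁻¹) ^ v P = ((q : ℝ) ^ wt d v)⁻¹ := by
  simp_rw [inv_pow, ← pow_mul]
  rw [Finset.prod_inv_distrib, Finset.prod_pow_eq_pow_sum]
  simp_rw [wt, mul_comm]

variable {d : A → ℕ} {N q k : ℕ}

lemma prod_large_le (hq : 2 ≤ q) (hdN : ∀ P, d P ≤ N)
    (hcard : ∀ m, 1 ≤ m → m ≤ N →
      (m : ℝ) * ((Finset.univ.filter fun P => d P = m).card : ℝ) ≤ (q : ℝ) ^ m + 1)
    (hk1 : 1 ≤ k) (hkN : k ≤ N) :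
    ∏ P ∈ Finset.univ.filter (fun P => P ∉ Finset.univ.filter fun P => d P ≤ k),
      (1 + (((q : ℝ) ^ d P)⁻¹ + 2 * (((q : ℝ) ^ d P)⁻¹) ^ 2)) ≤ Real.exp 5 * (N / k) := by
  have h := sum_degree_le hq hcard (a := 1) (b := 2) zero_le_one zero_le_two k N le_rfl
  have h2 := sum_Ioc_one_div_le_log hk1 hkN
  have hk : (0 : ℝ) < k := by exact_mod_cast hk1
  have hN : (0 : ℝ) < N := by exact_mod_cast (by omega)
  have hset : Finset.univ.filter (fun P => P ∉ Finset.univ.filter fun P => d P ≤ k) =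
      Finset.univ.filter (fun P => k < d P ∧ d P ≤ N) := by
    ext P
    simp [hdN P]
  rw [hset]
  calc _ ≤ ∏ P ∈ Finset.univ.filter (fun P => k < d P ∧ d P ≤ N),
        Real.exp (1 * ((q : ℝ) ^ d P)⁻¹ + 2 * (((q : ℝ) ^ d P)⁻¹) ^ 2) := by
        refine Finset.prod_le_prod (fun _ _ => by positivity) fun P _ => ?_
        rw [one_mul, add_comm]
        exact Real.add_one_le_exp _
    _ = Real.exp (∑ P ∈ Finset.univ.filter (fun P => k < d P ∧ d P ≤ N),
        (1 * ((q : ℝ) ^ d P)⁻¹ + 2 * (((q : ℝ) ^ d P)⁻¹) ^ 2)) := (Real.exp_sum _ _).symm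
    _ ≤ Real.exp (5 + (Real.log N - Real.log k)) := Real.exp_le_exp.mpr (by linarith)
    _ = _ := by
        rw [Real.exp_add, Real.exp_sub, Real.exp_log hN, Real.exp_log hk]

lemma sum_small_le {a b x : ℝ} (hq : 2 ≤ q) (hd : ∀ P, 1 ≤ d P)
    (hcard : ∀ m, 1 ≤ m → m ≤ N →
      (m : ℝ) * ((Finset.univ.filter fun P => d P = m).card : ℝ) ≤ (q : ℝ) ^ m + 1)
    (hk1 : 1 ≤ k) (hkN : k ≤ N) (ha : 0 ≤ a) (hb : 0 ≤ b)
    (hx : a * Real.log k + 2 * (a + b) ≤ x) :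
    ∑ P ∈ Finset.univ.filter (fun P => d P ≤ k),
      (a * ((q : ℝ) ^ d P)⁻¹ + b * (((q : ℝ) ^ d P)⁻¹) ^ 2) ≤ x := by
  have h := sum_degree_le hq hcard ha hb 0 k hkN
  have h2 := sum_Ioc_zero_one_div_le_log hk1
  have hset : Finset.univ.filter (fun P => d P ≤ k) =
      Finset.univ.filter (fun P => 0 < d P ∧ d P ≤ k) := by
    ext P
    simp [Nat.lt_of_lt_of_le Nat.zero_lt_one (hd P)]
  rw [hset]
  nlinarith

lemma inv_pow_le_half (hq : 2 ≤ q) {m : ℕ} (hm : 1 ≤ m) : ((q : ℝ) ^ m)⁻¹ ≤ 1 / 2 := by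
  have hq' : (2 : ℝ) ≤ q := by exact_mod_cast hq
  rw [one_div]
  apply inv_anti₀ two_pos
  exact hq'.trans (le_self_pow₀ (by linarith) (by omega))

/-- Logarithmic sum over vectors with exactly `m` small primes. -/
lemma sum_smallOmega_eq_le {x : ℝ} (hq : 2 ≤ q) (hd : ∀ P, 1 ≤ d P) (hdN : ∀ P, d P ≤ N)
    (hcard : ∀ m, 1 ≤ m → m ≤ N →
      (m : ℝ) * ((Finset.univ.filter fun P => d P = m).card : ℝ) ≤ (q : ℝ) ^ m + 1)
    (hk1 : 1 ≤ k) (hkN : k ≤ N) (hx : Real.log k + 14 ≤ x) (m : ℕ) :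
    ∑ v ∈ (box A N).filter (fun v => smallOmega d k v = m), ((q : ℝ) ^ wt d v)⁻¹ ≤
      Real.exp 5 * (N / k) * (x ^ m / (m.factorial : ℝ)) := by
  have hhalf : ∀ P, ((q : ℝ) ^ d P)⁻¹ ≤ 1 / 2 := fun P => inv_pow_le_half hq (hd P)
  have h := sum_piFinset_le (Finset.univ.filter fun P => d P ≤ k)
    (fun _ : A => Finset.range (N + 1)) 0 (fun P j => (((q : ℝ) ^ d P)⁻¹) ^ j)
    (fun P => 1 * ((q : ℝ) ^ d P)⁻¹ + 2 * (((q : ℝ) ^ d P)⁻¹) ^ 2)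
    (fun P => 1 + (((q : ℝ) ^ d P)⁻¹ + 2 * (((q : ℝ) ^ d P)⁻¹) ^ 2))
    (fun P j => by positivity) (fun P _ => by simp)
    (fun P _ => by
      rw [one_mul]; exact sum_range_filter_pow_le (by positivity) (hhalf P) N)
    (fun P _ => sum_range_pow_le (by positivity) (hhalf P) (N + 1)) m
  simp_rw [prod_inv_pow] at h
  refine h.trans ?_
  have h1 := prod_large_le hq hdN hcard hk1 hkN
  have h2 := sum_small_le (a := 1) (b := 2) (x := x) hq hd hcard hk1 hkN zero_le_one zero_le_two
    (by linarith)
  refine mul_le_mul h1 ?_ (by positivity) (by positivity)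
  gcongr

/-- Logarithmic sum over pairs of vectors with exactly `m` small primes in total,
the first one having only small primes. -/
lemma sum_pair_smallOmega_eq_le {x : ℝ} (hq : 2 ≤ q) (hd : ∀ P, 1 ≤ d P) (hdN : ∀ P, d P ≤ N)
    (hcard : ∀ m, 1 ≤ m → m ≤ N →
      (m : ℝ) * ((Finset.univ.filter fun P => d P = m).card : ℝ) ≤ (q : ℝ) ^ m + 1)
    (hk1 : 1 ≤ k) (hkN : k ≤ N) (hx : Real.log k + 14 ≤ x) (m : ℕ) :
    ∑ p ∈ (box A N ×ˢ box A N).filter (fun p => (∀ P, k < d P → p.1 P = 0) ∧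
        smallOmega d k (p.1 + p.2) = m), ((q : ℝ) ^ wt d p.1)⁻¹ * ((q : ℝ) ^ wt d p.2)⁻¹ ≤
      Real.exp 5 * (N / k) * ((2 * x) ^ m / (m.factorial : ℝ)) := by
  have hhalf : ∀ P, ((q : ℝ) ^ d P)⁻¹ ≤ 1 / 2 := fun P => inv_pow_le_half hq (hd P)
  have h := sum_piFinset_le (Finset.univ.filter fun P => d P ≤ k)
    (fun P : A => (if d P ≤ k then Finset.range (N + 1) else {0}) ×ˢ Finset.range (N + 1)) (0, 0)
    (fun P t => (((q : ℝ) ^ d P)⁻¹) ^ t.1 * (((q : ℝ) ^ d P)⁻¹) ^ t.2)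
    (fun P => 2 * ((q : ℝ) ^ d P)⁻¹ + 12 * (((q : ℝ) ^ d P)⁻¹) ^ 2)
    (fun P => 1 + (((q : ℝ) ^ d P)⁻¹ + 2 * (((q : ℝ) ^ d P)⁻¹) ^ 2))
    (fun P j => by positivity) (fun P _ => by simp)
    (fun P hP => by
      rw [if_pos (Finset.mem_filter.mp hP).2]
      exact sum_product_filter_pow_le (by positivity) (hhalf P) N)
    (fun P hP => by
      rw [if_neg (by simpa using hP), Finset.sum_product]
      simpa using sum_range_pow_le (by positivity) (hhalf P) (N + 1)) m
  have h1 := prod_large_le hq hdN hcard hk1 hkN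
  have h2 := sum_small_le (a := 2) (b := 12) (x := 2 * x) hq hd hcard hk1 hkN zero_le_two
    (by norm_num) (by linarith)
  refine le_trans (le_of_eq ?_) (h.trans (mul_le_mul h1 ?_ (by positivity) (by positivity)))
  · refine Finset.sum_nbij' (fun p P => (p.1 P, p.2 P)) (fun t => (fun P => (t P).1, fun P => (t P).2))
      ?_ ?_ ?_ ?_ ?_
    · rintro ⟨g, h⟩ hp
      simp only [Finset.mem_filter, Finset.mem_product, mem_box] at hp
      obtain ⟨⟨hg, hh⟩, hsm, hm⟩ := hp
      simp only [Finset.mem_filter, Fintype.mem_piFinset, Finset.mem_product]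
      refine ⟨fun P => ⟨?_, by simpa [Nat.lt_succ_iff] using hh P⟩, ?_⟩
      · split_ifs with hP
        · simpa [Nat.lt_succ_iff] using hg P
        · simpa using hsm P (not_le.mp hP)
      · rw [← hm, smallOmega]
        congr 1
        ext P
        simp only [Finset.mem_filter, ne_eq, Prod.mk.injEq, Pi.add_apply]
        refine and_congr_right fun _ => ?_
        omega
    · intro t ht
      simp only [Finset.mem_filter, Fintype.mem_piFinset, Finset.mem_product] at ht
      obtain ⟨ht, hm⟩ := ht
      simp only [Finset.mem_filter, Finset.mem_product, mem_box]
      refine ⟨⟨fun P => ?_, fun P => ?_⟩, fun P hP => ?_, ?_⟩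
      · have := (ht P).1
        split_ifs at this with hP
        · simpa [Nat.lt_succ_iff] using this
        · rw [Finset.mem_singleton.mp this]; exact Nat.zero_le _
      · simpa [Nat.lt_succ_iff] using (ht P).2
      · have := (ht P).1
        rw [if_neg (not_le.mpr hP)] at this
        exact Finset.mem_singleton.mp this
      · rw [← hm, smallOmega]
        congr 1
        ext P
        simp only [Finset.mem_filter, ne_eq, Prod.ext_iff, Pi.add_apply]
        refine and_congr_right fun _ => ?_
        omega
    · intro p _; rfl
    · intro t _; rfl
    · intro p _
      rw [Finset.prod_mul_distrib, prod_inv_pow, prod_inv_pow]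
  · gcongr

end SmallFactors

section Divisors

variable {A G : Type*} [Fintype A] [DecidableEq A] [CommGroup G] [DecidableEq G] [Fintype G]
  {d : A → ℕ} {c : A → G} {N q k : ℕ}

lemma sum_filter_smallOmega {ι : Type*} (s : Finset ι) (f : ι → ℝ) (g : ι → ℕ)
    (t : Finset ℕ) (ht : ∀ i ∈ s, g i ∈ t) :
    ∑ i ∈ s, f i = ∑ m ∈ t, ∑ i ∈ s.filter (fun i => g i = m), f i :=
  (Finset.sum_fiberwise_of_maps_to ht f).symm

lemma card_many_small_le (hq : 2 ≤ q) (hd : ∀ P, 1 ≤ d P) (hdN : ∀ P, d P ≤ N)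
    (hG : Fintype.card G = q + 1)
    (hcount : ∀ r, 1 ≤ r → r ≤ N → ∀ b, (fib d c N r b).card = q ^ (r - 1))
    (hk1 : 1 ≤ k) (hkN : k ≤ N) (a : G) :
    (((fib d c N N a).filter fun v =>
      ⌈(Real.log k + 14) / Real.log 2⌉₊ ≤ smallOmega d k v).card : ℝ) ≤
      (q : ℝ) ^ (N - 1) * Real.exp 5 / k * (12 * (Real.exp 1 *
        Real.exp ((Real.log k + 14) * (1 - fordDelta)) / √(Real.log k + 14))) := by
  have hlogk : 0 ≤ Real.log k := Real.log_natCast_nonneg k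
  set x := Real.log k + 14 with hx
  set M := ⌈x / Real.log 2⌉₊ with hM
  have hcard := fun m h1 h2 => mul_card_filter_degree_le hd c hq hG hcount (m := m) h1 h2
  have hq' : (2 : ℝ) ≤ q := by exact_mod_cast hq
  have hN : (0 : ℝ) < N := by exact_mod_cast (by omega)
  have hk : (0 : ℝ) < k := by exact_mod_cast hk1
  have h := degree_mul_sum_fib_le hd c hq hG hcount le_rfl a
    (fun v => if M ≤ smallOmega d k v then 1 else 0)
    (fun v => if M - 1 ≤ smallOmega d k v then 1 else 0)
    (fun u => by split_ifs <;> norm_num)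
    (fun u P j => by
      have := smallOmega_add_single_le d k u P j
      split_ifs
      · exact le_rfl
      · omega
      · exact zero_le_one
      · exact le_rfl)
  rw [Finset.sum_boole] at h
  have h2 : ∑ u ∈ (box A N).filter (fun u => wt d u < N),
      (if M - 1 ≤ smallOmega d k u then (1 : ℝ) else 0) * ((q : ℝ) ^ wt d u)⁻¹ ≤
      ∑ m ∈ Finset.Ico (M - 1) (Fintype.card A + 1),
        ∑ v ∈ (box A N).filter (fun v => smallOmega d k v = m), ((q : ℝ) ^ wt d v)⁻¹ := by
    simp_rw [ite_mul, one_mul, zero_mul]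
    rw [← Finset.sum_filter, Finset.filter_filter,
      sum_filter_smallOmega _ _ (smallOmega d k) (Finset.Ico (M - 1) (Fintype.card A + 1))]
    · refine Finset.sum_le_sum fun m _ => ?_
      refine Finset.sum_le_sum_of_subset_of_nonneg ?_ fun _ _ _ => by positivity
      intro u
      simp only [Finset.mem_filter]
      tauto
    · intro u hu
      have := smallOmega_le_card d k u
      simp only [Finset.mem_filter] at hu
      rw [Finset.mem_Ico]
      omega
  have h3 := Finset.sum_le_sum fun m (_ : m ∈ Finset.Ico (M - 1) (Fintype.card A + 1)) =>
    sum_smallOmega_eq_le hq hd hdN hcard hk1 hkN hx.ge m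
  rw [← Finset.mul_sum] at h3
  have h4 := sum_upper_tail_le (x := x) (by linarith) (Fintype.card A + 1)
  rw [← hM] at h4
  have h5 := mul_le_mul_of_nonneg_left
    ((h2.trans h3).trans (mul_le_mul_of_nonneg_left h4 (by positivity)))
    (show 0 ≤ (q : ℝ) ^ (N - 1) by positivity)
  refine le_of_mul_le_mul_left ((h.trans h5).trans (le_of_eq ?_)) hN
  field_simp

lemma card_pairs_few_small_le (hq : 2 ≤ q) (hd : ∀ P, 1 ≤ d P) (hdN : ∀ P, d P ≤ N)
    (hG : Fintype.card G = q + 1)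
    (hcount : ∀ r, 1 ≤ r → r ≤ N → ∀ b, (fib d c N r b).card = q ^ (r - 1))
    (hk1 : 1 ≤ k) (hkN : 2 * k ≤ N) (a : G) :
    (((box A N ×ˢ box A N).filter fun p => wt d p.1 = k ∧ wt d p.2 = N - k ∧
      ev c p.1 * ev c p.2 = a ∧
      smallOmega d k (p.1 + p.2) < ⌈(Real.log k + 14) / Real.log 2⌉₊).card : ℝ) ≤
      4 * (q : ℝ) ^ (N - 1) * Real.exp 5 / k ^ 2 *
        (24 * Real.exp (Real.log k + 14) * (Real.exp 1 *
        Real.exp ((Real.log k + 14) * (1 - fordDelta)) / √(Real.log k + 14))) := by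
  have hlogk : 0 ≤ Real.log k := Real.log_natCast_nonneg k
  set x := Real.log k + 14 with hx
  set M := ⌈x / Real.log 2⌉₊ with hM
  have hcard := fun m h1 h2 => mul_card_filter_degree_le hd c hq hG hcount (m := m) h1 h2
  have hq' : (2 : ℝ) ≤ q := by exact_mod_cast hq
  have hN : (0 : ℝ) < N := by exact_mod_cast (by omega)
  have hk : (0 : ℝ) < k := by exact_mod_cast hk1
  set F : (A → ℕ) → (A → ℕ) → ℝ := fun g h => if smallOmega d k (g + h) < M then 1 else 0 with hF
  have hF0 : ∀ g h, 0 ≤ F g h := by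
    intro g h
    simp only [hF]
    split_ifs <;> norm_num
  have hFmono : ∀ g h g' h' : A → ℕ, (∀ P, g P + h P ≤ g' P + h' P) → F g' h' ≤ F g h := by
    intro g h g' h' hle
    have := smallOmega_mono (d := d) k (u := g + h) (v := g' + h') hle
    simp only [hF]
    split_ifs
    · exact le_rfl
    · omega
    · exact zero_le_one
    · exact le_rfl
  have hcardsum : (((box A N ×ˢ box A N).filter fun p => wt d p.1 = k ∧ wt d p.2 = N - k ∧
      ev c p.1 * ev c p.2 = a ∧ smallOmega d k (p.1 + p.2) < M).card : ℝ) =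
      ∑ h ∈ (box A N).filter (fun h => wt d h = N - k), ∑ g ∈ fib d c N k (a / ev c h), F g h := by
    rw [← Finset.sum_boole, Finset.sum_product_right, Finset.sum_filter]
    refine Finset.sum_congr rfl fun h _ => ?_
    rw [fib, Finset.sum_filter]
    by_cases hh : wt d h = N - k
    · simp only [hh, true_and, if_true]
      refine Finset.sum_congr rfl fun g _ => ?_
      simp only [hF, eq_div_iff_mul_eq', ← ite_and, and_assoc]
    · simp [hh]
  have h1 : (k : ℝ) * ∑ h ∈ (box A N).filter (fun h => wt d h = N - k),
        ∑ g ∈ fib d c N k (a / ev c h), F g h ≤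
      (q : ℝ) ^ (k - 1) * ∑ g ∈ (box A N).filter (fun g => wt d g < k), ((q : ℝ) ^ wt d g)⁻¹ *
        ∑ h ∈ (box A N).filter (fun h => wt d h = N - k), F g h := by
    rw [Finset.mul_sum]
    refine (Finset.sum_le_sum fun h _ => degree_mul_sum_fib_le hd c hq hG hcount (by omega) _
      (fun g => F g h) (fun g => F g h) (fun g => hF0 g h)
      (fun u P j => hFmono _ _ _ _ fun Q => by simp)).trans (le_of_eq ?_)
    rw [← Finset.mul_sum, Finset.sum_comm]
    congr 1
    refine Finset.sum_congr rfl fun g _ => ?_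
    rw [← Finset.sum_mul, mul_comm]
  have h2 : ∀ g, ((N - k : ℕ) : ℝ) * ∑ h ∈ (box A N).filter (fun h => wt d h = N - k), F g h ≤
      2 * (q : ℝ) ^ (N - k) * ∑ h ∈ (box A N).filter (fun h => wt d h < N - k),
        F g h * ((q : ℝ) ^ wt d h)⁻¹ := fun g =>
    degree_mul_sum_filter_le hd c hq hG hcount (by omega) (by omega)
      (fun h => F g h) (fun h => F g h) (fun h => hF0 g h)
      (fun u P j => hFmono _ _ _ _ fun Q => by simp)
  have h3 : ∑ g ∈ (box A N).filter (fun g => wt d g < k), ((q : ℝ) ^ wt d g)⁻¹ *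
        ∑ h ∈ (box A N).filter (fun h => wt d h < N - k), F g h * ((q : ℝ) ^ wt d h)⁻¹ ≤
      ∑ m ∈ Finset.range M, ∑ p ∈ (box A N ×ˢ box A N).filter (fun p =>
        (∀ P, k < d P → p.1 P = 0) ∧ smallOmega d k (p.1 + p.2) = m),
        ((q : ℝ) ^ wt d p.1)⁻¹ * ((q : ℝ) ^ wt d p.2)⁻¹ := by
    simp_rw [Finset.mul_sum]
    rw [← Finset.sum_product']
    simp_rw [hF, ite_mul, one_mul, zero_mul, mul_ite, mul_zero]
    rw [← Finset.sum_filter,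
      sum_filter_smallOmega _ _ (fun p => smallOmega d k (p.1 + p.2)) (Finset.range M)]
    · refine Finset.sum_le_sum fun m _ => ?_
      refine Finset.sum_le_sum_of_subset_of_nonneg ?_ fun _ _ _ => by positivity
      rintro ⟨g, h⟩
      simp only [Finset.mem_filter, Finset.mem_product]
      rintro ⟨⟨⟨⟨hg1, hg2⟩, hh1, hh2⟩, -⟩, hm⟩
      refine ⟨⟨hg1, hh1⟩, fun P hP => ?_, hm⟩
      by_contra h0
      have h4 : g P * d P ≤ wt d g :=
        Finset.single_le_sum (f := fun P => g P * d P) (fun _ _ => Nat.zero_le _)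
          (Finset.mem_univ P)
      have h5 : d P ≤ g P * d P := Nat.le_mul_of_pos_left _ (Nat.pos_of_ne_zero h0)
      omega
    · intro p hp
      simpa using (Finset.mem_filter.mp hp).2
  have h4 := Finset.sum_le_sum fun m (_ : m ∈ Finset.range M) =>
    sum_pair_smallOmega_eq_le hq hd hdN hcard hk1 (by omega) hx.ge m
  rw [← Finset.mul_sum] at h4
  have h5 := sum_lower_tail_le (x := x) (by linarith)
  rw [← hM] at h5
  have h6 := (h3.trans h4).trans (mul_le_mul_of_nonneg_left h5 (by positivity))
  have hNk : (N : ℝ) ≤ 2 * ((N - k : ℕ) : ℝ) := by exact_mod_cast (by omega)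
  have hNk0 : (0 : ℝ) < ((N - k : ℕ) : ℝ) := by linarith
  rw [hcardsum]
  set S := ∑ h ∈ (box A N).filter (fun h => wt d h = N - k),
    ∑ g ∈ fib d c N k (a / ev c h), F g h
  set K := 24 * Real.exp x * (Real.exp 1 * Real.exp (x * (1 - fordDelta)) / √x) with hK
  have hK0 : 0 ≤ K := by positivity
  have h7 : ((N - k : ℕ) : ℝ) * (k * S) ≤
      2 * (q : ℝ) ^ (N - 1) * (Real.exp 5 * (N / k) * K) := by
    calc ((N - k : ℕ) : ℝ) * (k * S) ≤ ((N - k : ℕ) : ℝ) * _ :=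
          mul_le_mul_of_nonneg_left h1 hNk0.le
      _ = (q : ℝ) ^ (k - 1) * ∑ g ∈ (box A N).filter (fun g => wt d g < k),
            ((q : ℝ) ^ wt d g)⁻¹ * (((N - k : ℕ) : ℝ) *
            ∑ h ∈ (box A N).filter (fun h => wt d h = N - k), F g h) := by
          rw [mul_left_comm, Finset.mul_sum]
          congr 1
          exact Finset.sum_congr rfl fun g _ => by ring
      _ ≤ (q : ℝ) ^ (k - 1) * ∑ g ∈ (box A N).filter (fun g => wt d g < k),
            ((q : ℝ) ^ wt d g)⁻¹ * (2 * (q : ℝ) ^ (N - k) *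
            ∑ h ∈ (box A N).filter (fun h => wt d h < N - k), F g h * ((q : ℝ) ^ wt d h)⁻¹) := by
          refine mul_le_mul_of_nonneg_left (Finset.sum_le_sum fun g _ => ?_) (by positivity)
          exact mul_le_mul_of_nonneg_left (h2 g) (by positivity)
      _ = 2 * (q : ℝ) ^ (N - 1) * ∑ g ∈ (box A N).filter (fun g => wt d g < k),
            ((q : ℝ) ^ wt d g)⁻¹ *
            ∑ h ∈ (box A N).filter (fun h => wt d h < N - k), F g h * ((q : ℝ) ^ wt d h)⁻¹ := by
          rw [show N - 1 = (k - 1) + (N - k) by omega, pow_add, Finset.mul_sum, Finset.mul_sum]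
          exact Finset.sum_congr rfl fun g _ => by ring
      _ ≤ _ := mul_le_mul_of_nonneg_left h6 (by positivity)
  have h8 : 2 * (q : ℝ) ^ (N - 1) * (Real.exp 5 * (N / k) * K) ≤
      ((N - k : ℕ) : ℝ) * (k * (4 * (q : ℝ) ^ (N - 1) * Real.exp 5 / k ^ 2 * K)) := by
    have e1 : ((N - k : ℕ) : ℝ) * (k * (4 * (q : ℝ) ^ (N - 1) * Real.exp 5 / k ^ 2 * K)) =
        2 * (q : ℝ) ^ (N - 1) * (Real.exp 5 * ((2 * ((N - k : ℕ) : ℝ)) / k) * K) := by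
      field_simp
      ring
    rw [e1]
    gcongr
  exact le_of_mul_le_mul_left (le_of_mul_le_mul_left (h7.trans h8) hNk0) hk

/-- The number of vectors of degree `N` and class `a` with a divisor of degree `k`. -/
lemma card_divisor_le (hq : 2 ≤ q) (hd : ∀ P, 1 ≤ d P) (hdN : ∀ P, d P ≤ N)
    (hG : Fintype.card G = q + 1)
    (hcount : ∀ r, 1 ≤ r → r ≤ N → ∀ b, (fib d c N r b).card = q ^ (r - 1))
    (hk1 : 1 ≤ k) (hkN : 2 * k ≤ N) (a : G) (S : Finset (A → ℕ))
    (hS : ∀ v ∈ S, v ∈ fib d c N N a ∧ ∃ g h, g + h = v ∧ wt d g = k) :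
    (S.card : ℝ) ≤ (12 * Real.exp 5 + 96 * Real.exp 19) * Real.exp (1 + 14 * (1 - fordDelta)) *
      (q : ℝ) ^ (N - 1) * (k : ℝ) ^ (-fordDelta) * (1 + Real.log k) ^ (-(1 / 2) : ℝ) := by
  have h1 := card_many_small_le hq hd hdN hG hcount hk1 (by omega) a
  have h2 := card_pairs_few_small_le hq hd hdN hG hcount hk1 hkN a
  have hlogk : 0 ≤ Real.log k := Real.log_natCast_nonneg k
  have hk : (0 : ℝ) < k := by exact_mod_cast hk1
  have hsub : S ⊆ ((fib d c N N a).filter fun v =>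
      ⌈(Real.log k + 14) / Real.log 2⌉₊ ≤ smallOmega d k v) ∪
      ((box A N ×ˢ box A N).filter fun p => wt d p.1 = k ∧ wt d p.2 = N - k ∧
        ev c p.1 * ev c p.2 = a ∧
        smallOmega d k (p.1 + p.2) < ⌈(Real.log k + 14) / Real.log 2⌉₊).image
        (fun p => p.1 + p.2) := by
    intro v hv
    obtain ⟨hv1, g, h, rfl, hg⟩ := hS v hv
    rw [Finset.mem_union]
    by_cases hM : ⌈(Real.log k + 14) / Real.log 2⌉₊ ≤ smallOmega d k (g + h)
    · exact Or.inl (Finset.mem_filter.mpr ⟨hv1, hM⟩)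
    · right
      obtain ⟨-, hw, he⟩ := Finset.mem_filter.mp hv1
      rw [wt_add] at hw
      rw [ev_add] at he
      refine Finset.mem_image.mpr ⟨(g, h), Finset.mem_filter.mpr
        ⟨Finset.mem_product.mpr ⟨mem_box_of_wt_le hd (show wt d g ≤ N by omega),
          mem_box_of_wt_le hd (show wt d h ≤ N by omega)⟩,
          hg, by dsimp only; omega, he, not_le.mp hM⟩, rfl⟩
  have hcard := (Finset.card_le_card hsub).trans
    ((Finset.card_union_le _ _).trans (Nat.add_le_add_left Finset.card_image_le _))
  have hcard' := (Nat.cast_le (α := ℝ)).mpr hcard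
  rw [Nat.cast_add] at hcard'
  refine (hcard'.trans (add_le_add h1 h2)).trans ?_
  have hsqrt : 1 / √(Real.log k + 14) ≤ (1 + Real.log k) ^ (-(1 / 2) : ℝ) := by
    rw [Real.rpow_neg (by linarith), ← Real.sqrt_eq_rpow, one_div]
    apply inv_anti₀ (Real.sqrt_pos.mpr (by linarith))
    exact Real.sqrt_le_sqrt (by linarith)
  have hexp : Real.exp 1 * Real.exp ((Real.log k + 14) * (1 - fordDelta)) =
      Real.exp (1 + 14 * (1 - fordDelta)) * (k * (k : ℝ) ^ (-fordDelta)) := by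
    have : (k : ℝ) * (k : ℝ) ^ (-fordDelta) = Real.exp (Real.log k * (1 - fordDelta)) := by
      rw [Real.rpow_def_of_pos hk]
      nth_rewrite 1 [← Real.exp_log hk]
      rw [← Real.exp_add]
      congr 1; ring
    rw [this, ← Real.exp_add, ← Real.exp_add]
    congr 1; ring
  have hek : Real.exp (Real.log k + 14) = k * Real.exp 14 := by
    rw [Real.exp_add, Real.exp_log hk]
  have h19 : Real.exp 19 = Real.exp 5 * Real.exp 14 := by
    rw [← Real.exp_add]; norm_num
  rw [hexp, hek, h19]
  calc _ = (12 * Real.exp 5 + 96 * (Real.exp 5 * Real.exp 14)) *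
        Real.exp (1 + 14 * (1 - fordDelta)) *
        (q : ℝ) ^ (N - 1) * (k : ℝ) ^ (-fordDelta) * (1 / √(Real.log k + 14)) := by
        field_simp
        ring
    _ ≤ _ := mul_le_mul_of_nonneg_left hsqrt (by positivity)

end Divisors

section DaggerSymmetric

variable {F : Type} [Field F] {σ : F →+* F}

/-- Monic †-symmetric polynomials. -/
def MonicDagger (σ : F →+* F) (f : F[X]) : Prop := f.Monic ∧ IsDaggerSymm σ f

lemma MonicDagger.one : MonicDagger σ 1 := by
  refine ⟨monic_one, by simp, by simp [reverse, reflect_one]⟩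

lemma reverse_map_mul (f g : F[X]) :
    ((f * g).map σ).reverse = (f.map σ).reverse * (g.map σ).reverse := by
  rw [Polynomial.map_mul, reverse_mul_of_domain]

lemma MonicDagger.mul {f g : F[X]} (hf : MonicDagger σ f) (hg : MonicDagger σ g) :
    MonicDagger σ (f * g) := by
  refine ⟨hf.1.mul hg.1, ?_, ?_⟩
  · rw [mul_coeff_zero]; exact mul_ne_zero hf.2.1 hg.2.1
  · rw [reverse_map_mul, hf.2.2, hg.2.2, mul_coeff_zero, map_mul, C_mul]
    ring

lemma MonicDagger.ne_zero {f : F[X]} (hf : MonicDagger σ f) : f ≠ 0 := hf.1.ne_zero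

lemma MonicDagger.of_mul {f g : F[X]} (hfg : MonicDagger σ (f * g)) (hf : MonicDagger σ f) :
    MonicDagger σ g := by
  have h0 := hfg.2.1
  rw [mul_coeff_zero] at h0
  refine ⟨hf.1.of_mul_monic_left hfg.1, right_ne_zero_of_mul h0, ?_⟩
  have h := hfg.2.2
  rw [reverse_map_mul, hf.2.2, mul_coeff_zero, map_mul, C_mul] at h
  have hc : C (σ (f.coeff 0)) * f ≠ 0 :=
    mul_ne_zero (by simpa using hf.2.1) hf.ne_zero
  refine mul_left_cancel₀ hc ?_
  rw [h]; ring

lemma MonicDagger.coeff_zero {f : F[X]} (hf : MonicDagger σ f) :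
    σ (f.coeff 0) * f.coeff 0 = 1 := by
  have h := congrArg (fun p => p.coeff 0) hf.2.2
  simpa [coeff_zero_reverse, (hf.1.map σ).leadingCoeff] using h.symm

lemma MonicDagger.eq_one {f : F[X]} (hf : MonicDagger σ f) (h : f.natDegree = 0) : f = 1 :=
  hf.1.natDegree_eq_zero.mp h

/-- The †-symmetric polynomials which are not nontrivial products of †-symmetric polynomials. -/
def DaggerAtom (σ : F →+* F) (P : F[X]) : Prop :=
  MonicDagger σ P ∧ P ≠ 1 ∧
    ∀ g h, MonicDagger σ g → MonicDagger σ h → P = g * h → g = 1 ∨ h = 1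

lemma DaggerAtom.natDegree_pos {P : F[X]} (hP : DaggerAtom σ P) : 1 ≤ P.natDegree :=
  Nat.one_le_iff_ne_zero.mpr fun h => hP.2.1 (hP.1.eq_one h)

lemma DaggerAtom.eq_of_dvd {P Q : F[X]} (hP : DaggerAtom σ P) (hQ : DaggerAtom σ Q)
    (h : P ∣ Q) : P = Q := by
  obtain ⟨g, rfl⟩ := h
  rcases hQ.2.2 P g hP.1 (hQ.1.of_mul hP.1) rfl with h | h
  · exact absurd h hP.2.1
  · rw [h, mul_one]

lemma natDegree_reverse_map {p : F[X]} (hp : p.coeff 0 ≠ 0) :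
    (p.map σ).reverse.natDegree = p.natDegree := by
  have : (p.map σ).natTrailingDegree = 0 :=
    natTrailingDegree_eq_zero.mpr (Or.inr (by simpa using hp))
  rw [reverse_natDegree, this, natDegree_map, Nat.sub_zero]

lemma coeff_reverse_map {p : F[X]} {i : ℕ} (hi : i ≤ p.natDegree) :
    (p.map σ).reverse.coeff i = σ (p.coeff (p.natDegree - i)) := by
  rw [coeff_reverse, natDegree_map, revAt_le hi, coeff_map]

lemma reverse_map_reverse_map (hσ : ∀ x, σ (σ x) = x) {p : F[X]} (hp : p.coeff 0 ≠ 0) :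
    ((p.map σ).reverse.map σ).reverse = p := by
  ext i
  have hd := natDegree_reverse_map (σ := σ) hp
  by_cases hi : i ≤ p.natDegree
  · rw [coeff_reverse_map (by rw [hd]; exact hi), hd, coeff_reverse_map (Nat.sub_le _ _), hσ,
      Nat.sub_sub_self hi]
  · push Not at hi
    rw [coeff_eq_zero_of_natDegree_lt hi, coeff_eq_zero_of_natDegree_lt]
    refine lt_of_le_of_lt (reverse_natDegree_le _) ?_
    rw [natDegree_map, hd]; exact hi

/-- The polynomial `p†`. -/
noncomputable def dagger (σ : F →+* F) (p : F[X]) : F[X] :=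
  C (σ (p.coeff 0))⁻¹ * (p.map σ).reverse

lemma reverse_map_eq {p : F[X]} (hp : p.coeff 0 ≠ 0) :
    (p.map σ).reverse = C (σ (p.coeff 0)) * dagger σ p := by
  have : σ (p.coeff 0) ≠ 0 := by simpa using hp
  rw [dagger, ← mul_assoc, ← C_mul, mul_inv_cancel₀ this, C_1, one_mul]

lemma natDegree_dagger {p : F[X]} (hp : p.coeff 0 ≠ 0) :
    (dagger σ p).natDegree = p.natDegree := by
  have : σ (p.coeff 0) ≠ 0 := by simpa using hp
  rw [dagger, natDegree_C_mul (inv_ne_zero this), natDegree_reverse_map hp]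

lemma monic_dagger {p : F[X]} (hp : p.coeff 0 ≠ 0) : (dagger σ p).Monic := by
  have : σ (p.coeff 0) ≠ 0 := by simpa using hp
  rw [Monic, leadingCoeff, natDegree_dagger hp, dagger, coeff_C_mul, coeff_reverse_map le_rfl,
    Nat.sub_self, inv_mul_cancel₀ this]

lemma dagger_coeff_zero {p : F[X]} (hp : p.Monic) :
    (dagger σ p).coeff 0 = (σ (p.coeff 0))⁻¹ := by
  rw [dagger, coeff_C_mul, coeff_zero_reverse, (hp.map σ).leadingCoeff, mul_one]

lemma dagger_dvd {p f : F[X]} (hp : p.coeff 0 ≠ 0) (hf : MonicDagger σ f) (h : p ∣ f) :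
    dagger σ p ∣ f := by
  obtain ⟨g, rfl⟩ := h
  have h1 := hf.2.2
  rw [reverse_map_mul, reverse_map_eq hp] at h1
  have hu : IsUnit (C (σ ((p * g).coeff 0))) := by
    rw [isUnit_C]; exact IsUnit.mk0 _ (by simpa using hf.2.1)
  rw [← hu.dvd_mul_left, ← h1]
  exact (Dvd.intro_left _ rfl).mul_right _

lemma monicDagger_mul_dagger (hσ : ∀ x, σ (σ x) = x) {p : F[X]} (hm : p.Monic)
    (hp : p.coeff 0 ≠ 0) : MonicDagger σ (p * dagger σ p) := by
  have h0 : σ (p.coeff 0) ≠ 0 := by simpa using hp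
  refine ⟨hm.mul (monic_dagger hp), ?_, ?_⟩
  · rw [mul_coeff_zero, dagger_coeff_zero hm]
    exact mul_ne_zero hp (inv_ne_zero h0)
  · have h1 : ((dagger σ p).map σ).reverse = C (p.coeff 0)⁻¹ * p := by
      have h2 : (dagger σ p).map σ = C (p.coeff 0)⁻¹ * (p.map σ).reverse.map σ := by
        rw [dagger, Polynomial.map_mul, map_C, map_inv₀, hσ]
      rw [h2, reverse_mul_of_domain, reverse_map_reverse_map hσ hp, reverse_C]
    have h3 : σ (σ (p.coeff 0))⁻¹ = (p.coeff 0)⁻¹ := by rw [map_inv₀, hσ]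
    rw [reverse_map_mul, h1, reverse_map_eq hp, mul_coeff_zero, dagger_coeff_zero hm, map_mul,
      h3, C_mul]
    ring

lemma DaggerAtom.irreducible_or_exists (hσ : ∀ x, σ (σ x) = x) {P : F[X]} (hP : DaggerAtom σ P) :
    Irreducible P ∨ ∃ p, Irreducible p ∧ p.coeff 0 ≠ 0 ∧ IsCoprime p (dagger σ p) ∧
      P = p * dagger σ p := by
  have hnu : ¬ IsUnit P := fun h => hP.2.1 (hP.1.1.eq_one_of_isUnit h)
  obtain ⟨p, hpm, hpi, hpP⟩ := exists_monic_irreducible_factor P hnu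
  have hp0 : p.coeff 0 ≠ 0 := by
    obtain ⟨g, hg⟩ := hpP
    have := hP.1.2.1
    rw [hg, mul_coeff_zero] at this
    exact left_ne_zero_of_mul this
  by_cases hs : p = dagger σ p
  · left
    have hmd : MonicDagger σ p := ⟨hpm, hp0, by rw [reverse_map_eq hp0, ← hs]⟩
    obtain ⟨g, hg⟩ := hpP
    have hgd : MonicDagger σ g := MonicDagger.of_mul (hg ▸ hP.1) hmd
    rcases hP.2.2 p g hmd hgd hg with h | h
    · exact absurd (h ▸ isUnit_one) hpi.not_isUnit
    · rw [hg, h, mul_one]; exact hpi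
  · right
    have hcop : IsCoprime p (dagger σ p) := by
      rw [hpi.coprime_iff_not_dvd]
      intro h
      exact hs (eq_of_monic_of_dvd_of_natDegree_le hpm (monic_dagger hp0) h
        (natDegree_dagger hp0).le).symm
    refine ⟨p, hpi, hp0, hcop, ?_⟩
    obtain ⟨g, hg⟩ := hcop.mul_dvd hpP (dagger_dvd hp0 hP.1 hpP)
    have hmd := monicDagger_mul_dagger hσ hpm hp0
    have hgd : MonicDagger σ g := MonicDagger.of_mul (hg ▸ hP.1) hmd
    rcases hP.2.2 _ g hmd hgd hg with h | h
    · exact absurd (IsUnit.of_mul_eq_one _ h) hpi.not_isUnit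
    · rw [hg, h, mul_one]

lemma DaggerAtom.dvd_or_dvd (hσ : ∀ x, σ (σ x) = x) {P g h : F[X]} (hP : DaggerAtom σ P)
    (hg : MonicDagger σ g) (hh : MonicDagger σ h) (hd : P ∣ g * h) : P ∣ g ∨ P ∣ h := by
  rcases hP.irreducible_or_exists hσ with hi | ⟨p, hi, hp0, hcop, rfl⟩
  · exact hi.prime.dvd_or_dvd hd
  · rcases hi.prime.dvd_or_dvd ((Dvd.intro _ rfl).trans hd) with h | h
    · exact Or.inl (hcop.mul_dvd h (dagger_dvd hp0 hg h))
    · exact Or.inr (hcop.mul_dvd h (dagger_dvd hp0 hh h))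

instance finite_natDegree_le [Finite F] (n : ℕ) (p : F[X] → Prop) :
    Finite {f : F[X] // p f ∧ f.natDegree ≤ n} := by
  refine Finite.of_injective
    (fun f : {f : F[X] // p f ∧ f.natDegree ≤ n} => fun i : Fin (n + 1) => f.1.coeff i) ?_
  intro f g h
  ext i
  by_cases hi : i < n + 1
  · exact congrFun h ⟨i, hi⟩
  · rw [coeff_eq_zero_of_natDegree_lt (by have := f.2.2; omega),
      coeff_eq_zero_of_natDegree_lt (by have := g.2.2; omega)]

/-- The atoms of degree at most `n`. -/
abbrev AtomLE (σ : F →+* F) (n : ℕ) : Type := {P : F[X] // DaggerAtom σ P ∧ P.natDegree ≤ n}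

noncomputable instance [Finite F] (n : ℕ) : Fintype (AtomLE σ n) := Fintype.ofFinite _

/-- The polynomial with a given factorization into atoms. -/
noncomputable def prodPow [Finite F] {n : ℕ} (v : AtomLE σ n → ℕ) : F[X] := ∏ P, P.1 ^ v P

variable [Finite F] {n : ℕ}

lemma MonicDagger.pow {f : F[X]} (hf : MonicDagger σ f) (j : ℕ) : MonicDagger σ (f ^ j) := by
  induction j with
  | zero => simpa using MonicDagger.one
  | succ j ih => rw [pow_succ]; exact ih.mul hf

lemma monicDagger_prod_pow {n : ℕ} (s : Finset (AtomLE σ n)) (v : AtomLE σ n → ℕ) :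
    MonicDagger σ (∏ P ∈ s, P.1 ^ v P) :=
  Finset.prod_induction _ (MonicDagger σ) (fun _ _ => MonicDagger.mul) MonicDagger.one
    fun P _ => P.2.1.1.pow _

lemma monicDagger_prodPow (v : AtomLE σ n → ℕ) : MonicDagger σ (prodPow v) :=
  monicDagger_prod_pow _ v

lemma natDegree_prodPow (v : AtomLE σ n → ℕ) :
    (prodPow v).natDegree = wt (fun P : AtomLE σ n => P.1.natDegree) v := by
  rw [prodPow, natDegree_prod_of_monic _ _ fun P _ => (P.2.1.1.pow _).1, wt]
  exact Finset.sum_congr rfl fun P _ => P.2.1.1.1.natDegree_pow _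

lemma coeff_zero_prodPow (v : AtomLE σ n → ℕ) :
    (prodPow v).coeff 0 = ∏ P : AtomLE σ n, P.1.coeff 0 ^ v P := by
  simp [prodPow, coeff_zero_eq_eval_zero, eval_prod]

lemma prodPow_add (u v : AtomLE σ n → ℕ) : prodPow (u + v) = prodPow u * prodPow v := by
  simp [prodPow, pow_add, Finset.prod_mul_distrib]

lemma prodPow_zero : prodPow (0 : AtomLE σ n → ℕ) = 1 := by
  simp [prodPow]

lemma prodPow_single [DecidableEq (AtomLE σ n)] (P : AtomLE σ n) :
    prodPow (Pi.single P 1) = P.1 := by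
  rw [prodPow, Finset.prod_eq_single P]
  · simp
  · intro b _ hb; simp [Pi.single_eq_of_ne hb]
  · simp

lemma exists_prodPow_eq (f : F[X]) (hf : MonicDagger σ f) (hn : f.natDegree ≤ n) :
    ∃ v : AtomLE σ n → ℕ, prodPow v = f := by
  classical
  induction hm : f.natDegree using Nat.strong_induction_on generalizing f with
  | _ m ih =>
    by_cases h1 : f = 1
    · exact ⟨0, h1 ▸ prodPow_zero⟩
    by_cases ha : DaggerAtom σ f
    · exact ⟨Pi.single ⟨f, ha, hn⟩ 1, prodPow_single _⟩
    have : ∃ g h, MonicDagger σ g ∧ MonicDagger σ h ∧ f = g * h ∧ g ≠ 1 ∧ h ≠ 1 := by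
      by_contra! hc
      refine ha ⟨hf, h1, fun g h hg hh he => ?_⟩
      by_cases hg1 : g = 1
      · exact Or.inl hg1
      · exact Or.inr (hc g h hg hh he hg1)
    obtain ⟨g, h, hg, hh, rfl, hg1, hh1⟩ := this
    have hg0 : g.natDegree ≠ 0 := fun h => hg1 (hg.eq_one h)
    have hh0 : h.natDegree ≠ 0 := fun h => hh1 (hh.eq_one h)
    rw [hg.1.natDegree_mul hh.1] at hm hn
    obtain ⟨u, hu⟩ := ih g.natDegree (by omega) g hg (by omega) rfl
    obtain ⟨v, hv⟩ := ih h.natDegree (by omega) h hh (by omega) rfl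
    exact ⟨u + v, by rw [prodPow_add, hu, hv]⟩

lemma DaggerAtom.dvd_of_dvd_pow (hσ : ∀ x, σ (σ x) = x) {P g : F[X]} (hP : DaggerAtom σ P)
    (hg : MonicDagger σ g) {j : ℕ} (h : P ∣ g ^ j) : P ∣ g ∧ j ≠ 0 := by
  induction j with
  | zero =>
    rw [pow_zero] at h
    exact absurd (hP.1.1.eq_one_of_isUnit (isUnit_of_dvd_one h)) hP.2.1
  | succ j ih =>
    refine ⟨?_, j.succ_ne_zero⟩
    rw [pow_succ] at h
    exact (hP.dvd_or_dvd hσ (hg.pow j) hg h).elim (fun h => (ih h).1) id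

lemma ne_zero_of_dvd_prodPow (hσ : ∀ x, σ (σ x) = x) (P : AtomLE σ n) (v : AtomLE σ n → ℕ)
    (h : P.1 ∣ prodPow v) : v P ≠ 0 := by
  classical
  have key : ∀ s : Finset (AtomLE σ n), P.1 ∣ ∏ Q ∈ s, Q.1 ^ v Q → v P ≠ 0 := by
    intro s
    induction s using Finset.induction_on with
    | empty =>
      intro h
      rw [Finset.prod_empty] at h
      exact absurd (P.2.1.1.1.eq_one_of_isUnit (isUnit_of_dvd_one h)) P.2.1.2.1
    | insert Q s hQ ih =>
      intro h
      rw [Finset.prod_insert hQ] at h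
      rcases P.2.1.dvd_or_dvd hσ (Q.2.1.1.pow _) (monicDagger_prod_pow s v) h with h | h
      · obtain ⟨h1, h2⟩ := P.2.1.dvd_of_dvd_pow hσ Q.2.1.1 h
        rwa [Subtype.ext (P.2.1.eq_of_dvd Q.2.1 h1)]
      · exact ih h
  exact key _ h

lemma prodPow_injective (hσ : ∀ x, σ (σ x) = x) :
    Function.Injective (prodPow : (AtomLE σ n → ℕ) → F[X]) := by
  classical
  intro u v huv
  have hd : ∀ P : AtomLE σ n, 1 ≤ P.1.natDegree := fun P => P.2.1.natDegree_pos
  induction hm : wt (fun P : AtomLE σ n => P.1.natDegree) u using Nat.strong_induction_on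
    generalizing u v with
  | _ m ih =>
    by_cases h0 : u = 0
    · subst h0
      have h1 : (prodPow v).natDegree = 0 := by rw [← huv, prodPow_zero, natDegree_one]
      rw [natDegree_prodPow] at h1
      funext P
      have := le_wt hd v P
      simp only [Pi.zero_apply]
      omega
    · obtain ⟨P, hP⟩ := Function.ne_iff.mp h0
      have hsplit : ∀ w : AtomLE σ n → ℕ, w P ≠ 0 → w = Pi.single P 1 + (w - Pi.single P 1) := by
        intro w hw
        funext Q
        by_cases hQ : Q = P
        · subst hQ; simp; omega
        · simp [Pi.single_eq_of_ne hQ]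
      have hu := hsplit u hP
      have hdvd : P.1 ∣ prodPow u := by
        rw [hu, prodPow_add, prodPow_single]; exact Dvd.intro _ rfl
      have hv := hsplit v (ne_zero_of_dvd_prodPow hσ P v (huv ▸ hdvd))
      set u' := u - Pi.single P 1
      set v' := v - Pi.single P 1
      rw [hu, hv, prodPow_add, prodPow_add, prodPow_single] at huv
      have h' := mul_left_cancel₀ P.2.1.1.ne_zero huv
      have hw : wt (fun P : AtomLE σ n => P.1.natDegree) u' < m := by
        rw [hu, wt_add, wt_single] at hm
        have := hd P
        omega
      rw [hu, hv, ih _ hw h' rfl]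

end DaggerSymmetric

section CoefficientCount

variable {F : Type} [Field F] {σ : F →+* F}

lemma card_twisted_fixed_points [Fintype F] {q0 : ℕ} (hF : Fintype.card F = q0 ^ 2)
    (hσ : ∀ x, σ (σ x) = x) {θ : F} (hθ : σ θ ≠ θ) {a : F} (ha : σ a * a = 1) (m : ℕ) :
    Nat.card {c : Fin m → F // ∀ i, c i = a * σ (c i.rev)} = q0 ^ m := by
  have hθ' : θ - σ θ ≠ 0 := sub_ne_zero.mpr hθ.symm
  let Φ : {c : Fin m → F // ∀ i, c i = a * σ (c i.rev)} ×
      {c : Fin m → F // ∀ i, c i = a * σ (c i.rev)} → (Fin m → F) :=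
    fun x i => x.1.1 i + θ * x.2.1 i
  have hΦ : Function.Bijective Φ := by
    constructor
    · rintro ⟨⟨u, hu⟩, v, hv⟩ ⟨⟨u', hu'⟩, v', hv'⟩ h
      have h1 : ∀ i, u i + θ * v i = u' i + θ * v' i := fun i => congrFun h i
      have hvv : ∀ i, v i = v' i := by
        intro i
        have h2 := congrArg (fun x => a * σ x) (h1 i.rev)
        simp only [map_add, map_mul] at h2
        have h3 : u i + σ θ * v i = u' i + σ θ * v' i := by
          rw [hu i, hv i, hu' i, hv' i]
          linear_combination h2
        have h4 : (θ - σ θ) * (v i - v' i) = 0 := by linear_combination h1 i - h3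
        exact sub_eq_zero.mp ((mul_eq_zero.mp h4).resolve_left hθ')
      have huu : ∀ i, u i = u' i := fun i => by
        have := h1 i
        rw [hvv i] at this
        exact add_right_cancel this
      simp only [Prod.mk.injEq, Subtype.mk.injEq]
      exact ⟨funext huu, funext hvv⟩
    · intro c
      let v : Fin m → F := fun i => (c i - a * σ (c i.rev)) / (θ - σ θ)
      have hc : ∀ i, c i = (θ - σ θ) * v i + a * σ (c i.rev) := fun i => by
        simp only [v]; field_simp; ring
      have hv : ∀ i, v i = a * σ (v i.rev) := by
        intro i
        have h1 := congrArg (fun x => a * σ x) (hc i.rev)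
        simp only [map_add, map_mul, map_sub, hσ, Fin.rev_rev] at h1
        have h2 : (θ - σ θ) * (v i - a * σ (v i.rev)) = 0 := by
          linear_combination -h1 - hc i - c i * ha
        exact sub_eq_zero.mp ((mul_eq_zero.mp h2).resolve_left hθ')
      refine ⟨⟨⟨fun i => c i - θ * v i, fun i => ?_⟩, ⟨v, hv⟩⟩, ?_⟩
      · simp only [map_sub, map_mul]
        linear_combination hc i - σ θ * hv i
      · funext i; simp [Φ]
  have h := Nat.card_congr (Equiv.ofBijective Φ hΦ)
  rw [Nat.card_prod, Nat.card_eq_fintype_card (α := Fin m → F), Fintype.card_fun, hF,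
    Fintype.card_fin, ← pow_mul, mul_comm 2 m, pow_mul, sq] at h
  exact Nat.mul_self_inj.mp h

lemma MonicDagger.coeff_eq {f : F[X]} (hf : MonicDagger σ f) {i : ℕ} (hi : i ≤ f.natDegree) :
    f.coeff i = f.coeff 0 * σ (f.coeff (f.natDegree - i)) := by
  have h := congrArg (fun p => p.coeff i) hf.2.2
  simp only [coeff_reverse_map hi, coeff_C_mul] at h
  rw [h]
  linear_combination -f.coeff i * hf.coeff_zero

lemma exists_monicDagger_of_coeff {a : F} (ha : σ a * a = 1) {m : ℕ} {c : Fin m → F}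
    (hc : ∀ i, c i = a * σ (c i.rev)) :
    ∃ f, MonicDagger σ f ∧ f.natDegree = m + 1 ∧ f.coeff 0 = a ∧
      ∀ i : Fin m, f.coeff (i + 1) = c i := by
  classical
  set g : F[X] := ofFn (m + 1) (Fin.cons a c : Fin (m + 1) → F) with hg
  have hgd : g.degree < ((m + 1 : ℕ) : WithBot ℕ) := ofFn_degree_lt _
  set f : F[X] := X ^ (m + 1) + g with hf
  have hmon : f.Monic := monic_X_pow_add hgd
  have hdeg : f.natDegree = m + 1 := by
    rw [hf, natDegree_add_eq_left_of_degree_lt, natDegree_X_pow]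
    rwa [degree_X_pow]
  have hcoeff : ∀ i (hi : i < m + 1), f.coeff i = (Fin.cons a c : Fin (m + 1) → F) ⟨i, hi⟩ := by
    intro i hi
    rw [hf, coeff_add, coeff_X_pow, if_neg hi.ne, zero_add, hg, ofFn_coeff_eq_val_of_lt _ hi]
  have h0 : f.coeff 0 = a := by rw [hcoeff 0 (Nat.succ_pos m)]; rfl
  have hs : ∀ i : Fin m, f.coeff (i + 1) = c i := fun i => by
    rw [hcoeff _ (Nat.succ_lt_succ i.2)]; rfl
  have htop : f.coeff (m + 1) = 1 := by rw [← hdeg]; exact hmon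
  have ha0 : a ≠ 0 := right_ne_zero_of_mul_eq_one ha
  have hf0 : f.coeff 0 ≠ 0 := h0 ▸ ha0
  refine ⟨f, ⟨hmon, hf0, ?_⟩, hdeg, h0, hs⟩
  ext i
  rw [coeff_C_mul]
  by_cases hi : i ≤ m + 1
  · rw [coeff_reverse_map (hdeg ▸ hi), hdeg, h0]
    rcases Nat.eq_zero_or_pos i with rfl | hpos
    · rw [Nat.sub_zero, htop, h0, ha, map_one]
    rcases hi.eq_or_lt with rfl | hlt
    · rw [Nat.sub_self, htop, h0, mul_one]
    · obtain ⟨j, rfl⟩ := Nat.exists_eq_add_of_lt hpos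
      have hj : j < m := by omega
      have h1 : m + 1 - (0 + j + 1) = ((⟨j, hj⟩ : Fin m).rev : ℕ) + 1 := by
        simp [Fin.val_rev]; omega
      have h2 : f.coeff (0 + j + 1) = c ⟨j, hj⟩ := by rw [zero_add]; exact hs ⟨j, hj⟩
      rw [h1, hs, h2, hc ⟨j, hj⟩]
      linear_combination -σ (c (⟨j, hj⟩ : Fin m).rev) * ha
  · have hlt : f.natDegree < i := by omega
    rw [coeff_eq_zero_of_natDegree_lt hlt, mul_zero, coeff_eq_zero_of_natDegree_lt]
    rwa [natDegree_reverse_map hf0]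

lemma ncard_monicDagger [Fintype F] {q0 : ℕ} (hF : Fintype.card F = q0 ^ 2)
    (hσ : ∀ x, σ (σ x) = x) {θ : F} (hθ : σ θ ≠ θ) {a : F} (ha : σ a * a = 1) (m : ℕ) :
    {f : F[X] | MonicDagger σ f ∧ f.natDegree = m + 1 ∧ f.coeff 0 = a}.ncard = q0 ^ m := by
  rw [← card_twisted_fixed_points hF hσ hθ ha m, ← Nat.card_coe_set_eq]
  let Ψ : {f : F[X] | MonicDagger σ f ∧ f.natDegree = m + 1 ∧ f.coeff 0 = a} →
      {c : Fin m → F // ∀ i, c i = a * σ (c i.rev)} := fun f =>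
    ⟨fun i => f.1.coeff (i + 1), fun i => by
      obtain ⟨f, hf, hd, h0⟩ := f
      have h1 : m + 1 - (i + 1) = (i.rev : ℕ) + 1 := by
        rw [Fin.val_rev]; omega
      have h2 := hf.coeff_eq (i := i + 1) (by omega)
      rwa [hd, h0, h1] at h2⟩
  refine Nat.card_congr (Equiv.ofBijective Ψ ⟨?_, ?_⟩)
  · rintro ⟨f, hf, hd, h0⟩ ⟨g, hg, hd', h0'⟩ h
    have h1 : ∀ i : Fin m, f.coeff (i + 1) = g.coeff (i + 1) :=
      fun i => congrFun (congrArg Subtype.val h) i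
    refine Subtype.ext (Polynomial.ext fun i => ?_)
    rcases i with _ | i
    · exact h0.trans h0'.symm
    rcases lt_trichotomy i m with hi | rfl | hi
    · exact h1 ⟨i, hi⟩
    · have e1 := hf.1.coeff_natDegree
      have e2 := hg.1.coeff_natDegree
      rw [hd] at e1
      rw [hd'] at e2
      exact e1.trans e2.symm
    · change f.coeff (i + 1) = g.coeff (i + 1)
      rw [coeff_eq_zero_of_natDegree_lt (by omega), coeff_eq_zero_of_natDegree_lt (by omega)]
  · rintro ⟨c, hc⟩
    obtain ⟨f, hf, hd, h0, hs⟩ := exists_monicDagger_of_coeff ha hc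
    exact ⟨⟨f, hf, hd, h0⟩, Subtype.ext (funext hs)⟩

end CoefficientCount

section FiniteField

variable {F : Type} [Field F] [Fintype F] {σ : F →+* F} {q0 : ℕ}

lemma card_rootsOfUnity_of_card_eq_sq (hq : 2 ≤ q0) (hF : Fintype.card F = q0 ^ 2) :
    Nat.card (rootsOfUnity (q0 + 1) F) = q0 + 1 := by
  have h1 : rootsOfUnity (q0 + 1) F = (powMonoidHom (q0 + 1) : Fˣ →* Fˣ).ker := by
    ext x; simp [mem_rootsOfUnity, MonoidHom.mem_ker]
  have h2 : Nat.card Fˣ = (q0 - 1) * (q0 + 1) := by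
    rw [Nat.card_units, Nat.card_eq_fintype_card, hF]
    obtain ⟨k, rfl⟩ := Nat.exists_eq_add_of_le' hq
    simp only [show k + 2 - 1 = k + 1 from rfl]
    rw [Nat.sub_eq_iff_eq_add (Nat.one_le_pow _ _ (by omega))]
    ring
  rw [h1, IsCyclic.card_powMonoidHom_ker, h2, Nat.gcd_mul_left_left]

lemma involutive_of_pow (hF : Fintype.card F = q0 ^ 2) (hσ : ∀ x, σ x = x ^ q0) (x : F) :
    σ (σ x) = x := by
  rw [hσ, hσ, ← pow_mul, ← sq, ← hF, FiniteField.pow_card]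

lemma exists_map_ne (hq : 2 ≤ q0) (hF : Fintype.card F = q0 ^ 2) (hσ : ∀ x, σ x = x ^ q0) :
    ∃ θ, σ θ ≠ θ := by
  classical
  by_contra! h
  have hne : (X ^ q0 - X : F[X]) ≠ 0 := FiniteField.X_pow_card_sub_X_ne_zero F hq
  have h1 : (Finset.univ : Finset F) ⊆ (X ^ q0 - X : F[X]).roots.toFinset := fun x _ => by
    rw [Multiset.mem_toFinset, mem_roots hne, IsRoot.def]
    simp [← hσ, h]
  have h2 := (Finset.card_le_card h1).trans ((Multiset.toFinset_card_le _).trans (card_roots' _))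
  rw [Finset.card_univ, hF, FiniteField.X_pow_card_sub_X_natDegree_eq F hq, sq] at h2
  nlinarith

/-- The constant coefficient of an atom, as an element of the group of order `q0 + 1`. -/
noncomputable def atomConst (hσ : ∀ x, σ x = x ^ q0) {n : ℕ} (P : AtomLE σ n) :
    rootsOfUnity (q0 + 1) F :=
  rootsOfUnity.mkOfPowEq (P.1.coeff 0) (by rw [pow_succ, ← hσ]; exact P.2.1.1.coeff_zero)

lemma coe_ev_atomConst (hσ : ∀ x, σ x = x ^ q0) {n : ℕ} (v : AtomLE σ n → ℕ) :
    (((ev (atomConst hσ) v : rootsOfUnity (q0 + 1) F) : Fˣ) : F) = (prodPow v).coeff 0 := by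
  rw [coeff_zero_prodPow, ev]
  simp [atomConst]

open Classical in
lemma image_prodPow_fib (hσ : ∀ x, σ x = x ^ q0) {n r : ℕ}
    (hr : r ≤ n) (b : rootsOfUnity (q0 + 1) F) :
    prodPow '' (↑(fib (fun P : AtomLE σ n => P.1.natDegree) (atomConst hσ) n r b) :
        Set (AtomLE σ n → ℕ)) =
      {f : F[X] | MonicDagger σ f ∧ f.natDegree = r ∧ f.coeff 0 = ((b : Fˣ) : F)} := by
  ext f
  simp only [Set.mem_image, Finset.mem_coe, fib, Finset.mem_filter, Set.mem_ofPred_eq]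
  constructor
  · rintro ⟨v, ⟨-, hw, he⟩, rfl⟩
    exact ⟨monicDagger_prodPow v, by rw [natDegree_prodPow, hw], by rw [← coe_ev_atomConst hσ, he]⟩
  · rintro ⟨hf, hd, h0⟩
    obtain ⟨v, rfl⟩ := exists_prodPow_eq (n := n) f hf (hd.trans_le hr)
    rw [natDegree_prodPow] at hd
    refine ⟨v, ⟨mem_box_of_wt_le (fun P => P.2.1.natDegree_pos) (hd.trans_le hr), hd, ?_⟩, rfl⟩
    refine Subtype.ext (Units.ext ?_)
    rw [coe_ev_atomConst, h0]

open Classical in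
lemma card_fib_atoms (hq : 2 ≤ q0) (hF : Fintype.card F = q0 ^ 2) (hσ : ∀ x, σ x = x ^ q0)
    {n r : ℕ} (hr1 : 1 ≤ r) (hr : r ≤ n) (b : rootsOfUnity (q0 + 1) F) :
    (fib (fun P : AtomLE σ n => P.1.natDegree) (atomConst hσ) n r b).card = q0 ^ (r - 1) := by
  have hinv := involutive_of_pow hF hσ
  obtain ⟨θ, hθ⟩ := exists_map_ne hq hF hσ
  have hb : σ ((b : Fˣ) : F) * ((b : Fˣ) : F) = 1 := by
    rw [hσ, ← pow_succ]
    exact (mem_rootsOfUnity' _ _).mp b.2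
  have h := ncard_monicDagger hF hinv hθ hb (r - 1)
  rw [Nat.sub_add_cancel hr1, ← image_prodPow_fib hσ hr b,
    Set.ncard_image_of_injective _ (prodPow_injective hinv), Set.ncard_coe_finset] at h
  exact h

end FiniteField

/-- **Multiplication table problem, †-symmetric case.**
Over a field with `q0²` elements with involution `x ↦ x^{q0}`, the number of †-symmetric monic
polynomials of degree `n`, with constant coefficient `a ∈ U` (the subgroup of order `q0 + 1`),
having a †-symmetric monic divisor of degree `k` (where `1 ≤ k ≤ n/2`), is
`≤ C q0ⁿ⁻¹ k^{-δ} (1 + log k)^{-1/2}`. -/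
theorem stmt9 : ∃ C : ℝ, 0 < C ∧
    ∀ (F : Type) [Field F] [Fintype F], ∀ (q0 n k : ℕ) (σ : F →+* F) (a : F),
      IsPrimePow q0 → Fintype.card F = q0 ^ 2 → (∀ x : F, σ x = x ^ q0) →
      2 ≤ n → 1 ≤ k → 2 * k ≤ n → a ^ (q0 + 1) = 1 →
      ({f : F[X] | f.Monic ∧ IsDaggerSymm σ f ∧ f.natDegree = n ∧ f.coeff 0 = a ∧
          ∃ g : F[X], g.Monic ∧ IsDaggerSymm σ g ∧ g.natDegree = k ∧ g ∣ f}.ncard : ℝ) ≤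
        C * (q0 : ℝ) ^ (n - 1) * (k : ℝ) ^ (-fordDelta) *
          (1 + Real.log k) ^ (-(1 / 2) : ℝ) := by
  classical
  refine ⟨(12 * Real.exp 5 + 96 * Real.exp 19) * Real.exp (1 + 14 * (1 - fordDelta)),
    by positivity, ?_⟩
  intro F _ _ q0 n k σ a hq0 hF hσ _ hk hkn ha
  have hq := hq0.two_le
  have hinv := involutive_of_pow hF hσ
  let b : rootsOfUnity (q0 + 1) F := rootsOfUnity.mkOfPowEq a ha
  let d : AtomLE σ n → ℕ := fun P => P.1.natDegree
  let S := (fib d (atomConst hσ) n n b).filter fun v => ∃ g h, g + h = v ∧ wt d g = k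
  have hS : ∀ v ∈ S, v ∈ fib d (atomConst hσ) n n b ∧ ∃ g h, g + h = v ∧ wt d g = k :=
    fun v hv => Finset.mem_filter.mp hv
  refine le_trans ?_ (card_divisor_le (A := AtomLE σ n) hq (fun P => P.2.1.natDegree_pos)
    (fun P => P.2.2) ?_ (fun r hr1 hr c => card_fib_atoms hq hF hσ hr1 hr c) hk hkn b S hS)
  · rw [← Set.ncard_coe_finset, ← Set.ncard_image_of_injective _ (prodPow_injective hinv)]
    refine Nat.cast_le.mpr (Set.ncard_le_ncard ?_ (Set.toFinite _))
    rintro f ⟨hm, hs, hd, h0, g, hgm, hgs, hgd, h, rfl⟩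
    have hg : MonicDagger σ g := ⟨hgm, hgs⟩
    have hf : MonicDagger σ (g * h) := ⟨hm, hs⟩
    have hh : MonicDagger σ h := hf.of_mul hg
    have hmem : g * h ∈ prodPow '' (↑(fib d (atomConst hσ) n n b) : Set (AtomLE σ n → ℕ)) := by
      rw [image_prodPow_fib hσ le_rfl]
      exact ⟨hf, hd, h0⟩
    obtain ⟨v, hv, hvf⟩ := hmem
    rw [hgm.natDegree_mul hh.1] at hd
    obtain ⟨u, hu⟩ := exists_prodPow_eq (n := n) g hg (by omega)
    obtain ⟨w, hw⟩ := exists_prodPow_eq (n := n) h hh (by omega)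
    refine ⟨v, Finset.mem_coe.mpr (Finset.mem_filter.mpr ⟨hv, u, w, ?_, ?_⟩), hvf⟩
    · exact prodPow_injective hinv (by rw [prodPow_add, hu, hw, hvf])
    · rw [← natDegree_prodPow, hu, hgd]
  · rw [← Nat.card_eq_fintype_card]
    exact card_rootsOfUnity_of_card_eq_sq hq hF
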